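/- arXiv:2209.03318 — 3 statements merged into one kernel-verified Lean document; each statement's English description precedes it below -/
import Mathlib

section
/- Let Λ be a random measure on P₂(ℝᵈ) (i.e., a probability measure on the space P₂(ℝᵈ)) such that the functional F(ν) = E[W₂(ν, Λ)] is not identically infinite. Then F admits a minimizer ν* ∈ P₂(ℝᵈ), i.e., there exists ν* ∈ P₂(ℝᵈ) with F(ν*) = inf_{ν ∈ P₂(ℝᵈ)} F(ν). -/
open MeasureTheory Filter Set
open scoped ENNReal NNReal

noncomputable section

abbrev Rd (d : ℕ) := EuclideanSpace ℝ (Fin d)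

/-- `π` is a coupling of `μ` and `ν`. -/
def IsCoupling {α : Type*} [MeasurableSpace α] (π : Measure (α × α)) (μ ν : Measure α) : Prop :=
  π.map Prod.fst = μ ∧ π.map Prod.snd = ν

/-- Squared transport cost with ground cost `c`. -/
noncomputable def transportCost2 {α : Type*} [MeasurableSpace α] (c : α → α → ℝ≥0∞)
    (μ ν : Measure α) : ℝ≥0∞ :=
  ⨅ π ∈ {π : Measure (α × α) | IsCoupling π μ ν}, ∫⁻ q, c q.1 q.2 ^ 2 ∂π

/-- 2-Wasserstein distance with ground cost `c`. -/
noncomputable def wasserstein2 {α : Type*} [MeasurableSpace α] (c : α → α → ℝ≥0∞)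
    (μ ν : Measure α) : ℝ≥0∞ :=
  transportCost2 c μ ν ^ (1 / 2 : ℝ)

/-- The 2-Wasserstein distance on a normed measurable space. -/
noncomputable def W2 {α : Type*} [MeasurableSpace α] [EDist α] (μ ν : Measure α) : ℝ≥0∞ :=
  wasserstein2 (fun x y => edist x y) μ ν

/-- `μ ∈ P₂`: a Borel probability measure with finite second moment. -/
def MemP2 {α : Type*} [MeasurableSpace α] [NormedAddCommGroup α] (μ : Measure α) : Prop :=
  IsProbabilityMeasure μ ∧ ∫⁻ x, (‖x‖₊ : ℝ≥0∞) ^ 2 ∂μ < ⊤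

section ProbabilityMeasureTopology

variable {X : Type*} [TopologicalSpace X] [MeasurableSpace X]

/-- Integration of a nonnegative continuous function is lower semicontinuous for the weak
topology. -/
lemma isClosed_setOf_lintegral_le [OpensMeasurableSpace X] {g : X → ℝ≥0} (hg : Continuous g)
    (r : ℝ≥0∞) : IsClosed {π : ProbabilityMeasure X | ∫⁻ x, g x ∂(π : Measure X) ≤ r} := by
  have key : {π : ProbabilityMeasure X | ∫⁻ x, g x ∂(π : Measure X) ≤ r}
      = ⋂ n : ℕ, {π : ProbabilityMeasure X |
          ∫⁻ x, ((min (g x) (n : ℝ≥0) : ℝ≥0) : ℝ≥0∞) ∂(π : Measure X) ≤ r} := by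
    ext π
    simp only [mem_ofPred_eq, mem_iInter]
    have hsup : ∫⁻ x, g x ∂(π : Measure X)
        = ⨆ n : ℕ, ∫⁻ x, ((min (g x) (n : ℝ≥0) : ℝ≥0) : ℝ≥0∞) ∂(π : Measure X) := by
      rw [← lintegral_iSup]
      · congr 1
        ext x
        apply le_antisymm
        · obtain ⟨n, hn⟩ := exists_nat_ge (g x)
          exact le_iSup_of_le n (by simp [min_eq_left hn])
        · exact iSup_le fun n ↦ by exact_mod_cast min_le_left _ _
      · exact fun n ↦ ((hg.min continuous_const).measurable).coe_nnreal_ennreal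
      · intro m n hmn x
        have : (m : ℝ≥0) ≤ n := by exact_mod_cast hmn
        exact ENNReal.coe_le_coe.2 (min_le_min le_rfl this)
    rw [hsup, iSup_le_iff]
  rw [key]
  refine isClosed_iInter fun n ↦ ?_
  let f : BoundedContinuousFunction X ℝ≥0 :=
    BoundedContinuousFunction.mkOfBound ⟨fun x ↦ min (g x) (n : ℝ≥0), hg.min continuous_const⟩
      (n : ℝ) (fun x y ↦ by
        rw [NNReal.dist_eq]
        simp only [ContinuousMap.coe_mk]
        have hx : ((min (g x) (n : ℝ≥0) : ℝ≥0) : ℝ) ≤ n := by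
          exact_mod_cast min_le_right (g x) (n : ℝ≥0)
        have hy : ((min (g y) (n : ℝ≥0) : ℝ≥0) : ℝ) ≤ n := by
          exact_mod_cast min_le_right (g y) (n : ℝ≥0)
        rw [abs_le]
        constructor <;>
          linarith [(min (g x) (n : ℝ≥0)).coe_nonneg, (min (g y) (n : ℝ≥0)).coe_nonneg])
  exact isClosed_le (ProbabilityMeasure.continuous_lintegral_boundedContinuousFunction f)
    continuous_const

/-- Probability measures with a uniform bound on the integral of a continuous function with
compact sublevel sets form a compact set. -/
lemma isCompact_setOf_lintegral_le [T2Space X] [BorelSpace X] {g : X → ℝ≥0} (hg : Continuous g)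
    (hK : ∀ n : ℕ, IsCompact {x | g x ≤ n}) {r : ℝ≥0∞} (hr : r ≠ ⊤) :
    IsCompact {π : ProbabilityMeasure X | ∫⁻ x, g x ∂(π : Measure X) ≤ r} := by
  lift r to ℝ≥0 using hr
  have hu : Tendsto (fun n : ℕ ↦ r / ((n : ℝ≥0) + 1)) atTop (nhds 0) := by
    rw [← NNReal.tendsto_coe]
    push_cast
    exact tendsto_const_nhds.div_atTop
      (tendsto_atTop_add_const_right _ _ tendsto_natCast_atTop_atTop)
  have hmono : Monotone fun n : ℕ ↦ {x | g x ≤ ((n + 1 : ℕ) : ℝ≥0)} := by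
    intro m n hmn x hx
    have : ((m + 1 : ℕ) : ℝ≥0) ≤ ((n + 1 : ℕ) : ℝ≥0) := by exact_mod_cast Nat.succ_le_succ hmn
    exact le_trans hx this
  refine (isCompact_setOfPred_probabilityMeasure_mass_eq_compl_isCompact_le hu
    (fun n ↦ hK (n + 1)) (Or.inr hmono)).of_isClosed_subset (isClosed_setOf_lintegral_le hg _) ?_
  intro π hπ n
  rw [← ENNReal.coe_le_coe, ProbabilityMeasure.ennreal_coeFn_eq_coeFn_toMeasure,
    ENNReal.coe_div (by positivity)]
  have hsub : {x | g x ≤ ((n + 1 : ℕ) : ℝ≥0)}ᶜ ⊆ {x | (((n : ℝ≥0) + 1 : ℝ≥0) : ℝ≥0∞) ≤ g x} := by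
    intro x hx
    simp only [mem_compl_iff, mem_ofPred_eq, not_le] at hx
    push_cast at hx
    exact ENNReal.coe_le_coe.2 hx.le
  refine (measure_mono hsub).trans ((meas_ge_le_lintegral_div
    hg.measurable.coe_nnreal_ennreal.aemeasurable (by simp) (by simp)).trans ?_)
  exact ENNReal.div_le_div_right hπ _

/-- Weakly compact sets of probability measures are measurable for the `σ`-algebra generated by
the evaluation maps. -/
lemma measurableSet_of_isCompact_probabilityMeasure [TopologicalSpace.PseudoMetrizableSpace X]
    [SecondCountableTopology X] [BorelSpace X] {K : Set (ProbabilityMeasure X)}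
    (hK : IsCompact K) : MeasurableSet K := by
  let B := TopologicalSpace.countableBasis X
  have : Countable B := (TopologicalSpace.countable_countableBasis X).to_subtype
  let F : Finset B → Set X := fun s ↦ ⋂ b ∈ s, (b : Set X)ᶜ
  have hF (s : Finset B) : IsClosed (F s) := isClosed_biInter fun b _ ↦
    (TopologicalSpace.isOpen_of_mem_countableBasis b.2).isClosed_compl
  let Φ : ProbabilityMeasure X → (Finset B × ℕ → ℝ≥0∞) :=
    fun π i ↦ ∫⁻ x, (hF i.1).apprSeq i.2 x ∂(π : Measure X)
  have hΦc : Continuous Φ := continuous_pi fun i ↦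
    ProbabilityMeasure.continuous_lintegral_boundedContinuousFunction _
  have hΦm : Measurable Φ := measurable_pi_lambda _ fun i ↦
    (Measure.measurable_lintegral
      ((hF i.1).apprSeq i.2).continuous.measurable.coe_nnreal_ennreal).comp measurable_subtype_coe
  have hΦi : Function.Injective Φ := by
    intro μ ν h
    apply Subtype.ext
    refine ext_of_generate_finite (μ := (μ : Measure X)) (ν := (ν : Measure X)) (range F)
      ?_ ?_ ?_ (by simp)
    · rw [BorelSpace.measurable_eq (α := X)]
      apply le_antisymm
      · rw [(TopologicalSpace.isBasis_countableBasis X).borel_eq_generateFrom]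
        refine MeasurableSpace.generateFrom_le fun b hb ↦ ?_
        have : MeasurableSet[MeasurableSpace.generateFrom (range F)] bᶜ :=
          MeasurableSpace.measurableSet_generateFrom ⟨{⟨b, hb⟩}, Finset.set_biInter_singleton _ _⟩
        simpa using this.compl
      · refine MeasurableSpace.generateFrom_le ?_
        rintro _ ⟨s, rfl⟩
        rw [← BorelSpace.measurable_eq (α := X)]
        exact (hF s).measurableSet
    · rintro _ ⟨s, rfl⟩ _ ⟨t, rfl⟩ _
      classical
      exact ⟨s ∪ t, Finset.set_biInter_inter s t _⟩
    · rintro _ ⟨s, rfl⟩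
      exact tendsto_nhds_unique (HasOuterApproxClosed.tendsto_lintegral_apprSeq (hF s) (μ : Measure X))
        ((HasOuterApproxClosed.tendsto_lintegral_apprSeq (hF s) (ν : Measure X)).congr
          fun n ↦ (congrFun h (s, n)).symm)
  rw [← hΦi.preimage_image K]
  exact hΦm (hK.image hΦc).isClosed.measurableSet

end ProbabilityMeasureTopology

section Wasserstein

lemma rpow_half_le_iff_le_sq {s t : ℝ≥0∞} : s ^ (1 / 2 : ℝ) ≤ t ↔ s ≤ t ^ 2 := by
  rw [one_div, ENNReal.rpow_inv_le_iff (by norm_num), ENNReal.rpow_ofNat]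

lemma le_rpow_half_iff_sq_le {s t : ℝ≥0∞} : s ≤ t ^ (1 / 2 : ℝ) ↔ s ^ 2 ≤ t := by
  rw [one_div, ENNReal.le_rpow_inv_iff (by norm_num), ENNReal.rpow_ofNat]

lemma exists_isCoupling_of_transportCost2_lt {E : Type*} [MeasurableSpace E]
    {c : E → E → ℝ≥0∞} {μ ν : Measure E} {r : ℝ≥0∞} (h : transportCost2 c μ ν < r) :
    ∃ π : Measure (E × E), IsCoupling π μ ν ∧ ∫⁻ q, c q.1 q.2 ^ 2 ∂π < r := by
  simp only [transportCost2, iInf_lt_iff] at h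
  obtain ⟨π, hπ, h⟩ := h
  exact ⟨π, hπ, h⟩

lemma IsCoupling.isProbabilityMeasure {E : Type*} [MeasurableSpace E] {π : Measure (E × E)}
    {μ ν : Measure E} (h : IsCoupling π μ ν) [hμ : IsProbabilityMeasure μ] :
    IsProbabilityMeasure π := by
  have := h.1 ▸ hμ
  exact (Measure.isProbabilityMeasure_map_iff measurable_fst.aemeasurable).1 this

variable {E : Type*} [NormedAddCommGroup E] [MeasurableSpace E]

lemma W2_le_iff {μ ν : Measure E} {a : ℝ≥0∞} :
    W2 μ ν ≤ a ↔ transportCost2 (fun x y ↦ edist x y) μ ν ≤ a ^ 2 :=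
  rpow_half_le_iff_le_sq

lemma le_W2_iff {μ ν : Measure E} {a : ℝ≥0∞} :
    a ≤ W2 μ ν ↔ a ^ 2 ≤ transportCost2 (fun x y ↦ edist x y) μ ν :=
  le_rpow_half_iff_sq_le

lemma isProbabilityMeasure_of_W2_ne_top {μ ν : Measure E} [IsProbabilityMeasure μ]
    (h : W2 μ ν ≠ ⊤) : IsProbabilityMeasure ν := by
  have h' : transportCost2 (fun x y ↦ edist x y) μ ν < ⊤ := by
    refine lt_of_le_of_lt (W2_le_iff.1 le_rfl) (ENNReal.pow_lt_top h.lt_top)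
  obtain ⟨π, hπ, -⟩ := exists_isCoupling_of_transportCost2_lt h'
  have := hπ.isProbabilityMeasure
  rw [← hπ.2]
  exact Measure.isProbabilityMeasure_map measurable_snd.aemeasurable

variable [BorelSpace E] [SecondCountableTopology E]

/-- The root second moment is `1`-Lipschitz for the Wasserstein distance. -/
lemma rpow_secondMoment_le_add (μ ν : Measure E) :
    (∫⁻ x, (‖x‖₊ : ℝ≥0∞) ^ 2 ∂μ) ^ (1 / 2 : ℝ)
      ≤ W2 μ ν + (∫⁻ x, (‖x‖₊ : ℝ≥0∞) ^ 2 ∂ν) ^ (1 / 2 : ℝ) := by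
  rw [← tsub_le_iff_right, le_W2_iff]
  refine le_iInf₂ fun π hπ ↦ ?_
  have hsq : Measurable fun x : E ↦ (‖x‖₊ : ℝ≥0∞) ^ 2 := by fun_prop
  have e : ∀ t : ℝ≥0∞, t ^ 2 = t ^ (2 : ℝ) := fun t ↦ by norm_num
  apply le_rpow_half_iff_sq_le.1
  rw [tsub_le_iff_right]
  conv_lhs => rw [← hπ.1, lintegral_map hsq measurable_fst]
  conv_rhs => rw [← hπ.2, lintegral_map hsq measurable_snd]
  simp only [e]
  refine le_trans ?_ (ENNReal.lintegral_Lp_add_le (f := fun q : E × E ↦ edist q.1 q.2)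
    (g := fun q : E × E ↦ (‖q.2‖₊ : ℝ≥0∞)) (by fun_prop) (by fun_prop) (by norm_num))
  refine ENNReal.rpow_le_rpow (lintegral_mono fun q ↦ ENNReal.rpow_le_rpow ?_ (by norm_num))
    (by norm_num)
  rw [Pi.add_apply, edist_nndist, nndist_eq_nnnorm]
  have := nnnorm_add_le (q.1 - q.2) q.2
  rw [sub_add_cancel] at this
  exact_mod_cast this

/-- Measures with bounded mean Wasserstein distance to a random measure in `P₂` have uniformly
bounded second moments. -/
lemma exists_secondMoment_le {Λ : Measure (Measure E)} [IsProbabilityMeasure Λ]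
    (hΛ : ∀ᵐ ν ∂Λ, MemP2 ν) {C : ℝ≥0∞} (hC : C ≠ ⊤) :
    ∃ M : ℝ≥0∞, M ≠ ⊤ ∧ ∀ μ : Measure E, ∫⁻ ν, W2 μ ν ∂Λ ≤ C →
      ∫⁻ x, (‖x‖₊ : ℝ≥0∞) ^ 2 ∂μ ≤ M := by
  let A : ℕ → Set (Measure E) := fun n ↦ {ν | ∫⁻ x, (‖x‖₊ : ℝ≥0∞) ^ 2 ∂ν ≤ n}
  have hA (n : ℕ) : MeasurableSet (A n) :=
    measurableSet_le (Measure.measurable_lintegral (by fun_prop)) measurable_const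
  obtain ⟨n, hn⟩ : ∃ n, Λ (A n) ≠ 0 := by
    by_contra! h
    have h0 : ∀ᵐ ν ∂Λ, ν ∉ ⋃ n, A n := measure_eq_zero_iff_ae_notMem.1 (measure_iUnion_null h)
    obtain ⟨ν, hν, hν'⟩ := (hΛ.and h0).exists
    obtain ⟨n, hn⟩ := ENNReal.exists_nat_gt hν.2.ne
    exact hν' (mem_iUnion.2 ⟨n, hn.le⟩)
  let D : ℝ≥0∞ := C / Λ (A n) + (n : ℝ≥0∞) ^ (1 / 2 : ℝ)
  refine ⟨D ^ 2, ENNReal.pow_ne_top (ENNReal.add_ne_top.2 ⟨ENNReal.div_ne_top hC hn,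
    ENNReal.rpow_ne_top_of_nonneg (by norm_num) (by simp)⟩), fun μ hμ ↦ ?_⟩
  apply rpow_half_le_iff_le_sq.1
  rw [← tsub_le_iff_right, ENNReal.le_div_iff_mul_le (Or.inl hn) (Or.inl (measure_ne_top _ _)),
    ← setLIntegral_const]
  refine le_trans (setLIntegral_mono' (hA n) fun ν hν ↦ ?_)
    ((setLIntegral_le_lintegral (A n) _).trans hμ)
  rw [tsub_le_iff_right]
  refine (rpow_secondMoment_le_add μ ν).trans ?_
  gcongr
  exact hν

variable [ProperSpace E]

/-- Plans with bounded second moment of the first marginal and bounded quadratic cost form a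
compact set. -/
lemma isCompact_setOf_plan {M r : ℝ≥0∞} (hM : M ≠ ⊤) (hr : r ≠ ⊤) :
    IsCompact {π : ProbabilityMeasure (E × E) |
      ∫⁻ q, (‖q.1‖₊ : ℝ≥0∞) ^ 2 ∂(π : Measure (E × E)) ≤ M ∧
      ∫⁻ q, edist q.1 q.2 ^ 2 ∂(π : Measure (E × E)) ≤ r} := by
  have hg : Continuous fun q : E × E ↦ ‖q.1‖₊ ^ 2 + nndist q.1 q.2 ^ 2 := by fun_prop
  have hcompact (n : ℕ) : IsCompact {q : E × E | ‖q.1‖₊ ^ 2 + nndist q.1 q.2 ^ 2 ≤ (n : ℝ≥0)} := by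
    refine (isCompact_closedBall (0 : E × E) (2 * (n + 1))).of_isClosed_subset
      (isClosed_le hg continuous_const) fun q hq ↦ ?_
    have hq' : ‖q.1‖ ^ 2 + dist q.1 q.2 ^ 2 ≤ n := by exact_mod_cast hq
    have h1 : ‖q.1‖ ≤ n + 1 := by nlinarith [norm_nonneg q.1, sq_nonneg (dist q.1 q.2)]
    have h2 : dist q.1 q.2 ≤ n + 1 := by
      nlinarith [dist_nonneg (x := q.1) (y := q.2), sq_nonneg ‖q.1‖]
    have h3 : ‖q.2‖ ≤ ‖q.1‖ + dist q.1 q.2 := by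
      rw [dist_eq_norm]
      simpa using norm_sub_le q.1 (q.1 - q.2)
    rw [mem_closedBall_zero_iff, Prod.norm_def]
    exact max_le (by linarith) (by linarith)
  have h1 : IsClosed {π : ProbabilityMeasure (E × E) |
      ∫⁻ q, (‖q.1‖₊ : ℝ≥0∞) ^ 2 ∂(π : Measure (E × E)) ≤ M} := by
    have h := isClosed_setOf_lintegral_le (X := E × E) (g := fun q ↦ ‖q.1‖₊ ^ 2) (by fun_prop) M
    simp only [ENNReal.coe_pow] at h
    exact h
  have h2 : IsClosed {π : ProbabilityMeasure (E × E) |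
      ∫⁻ q, edist q.1 q.2 ^ 2 ∂(π : Measure (E × E)) ≤ r} := by
    have h := isClosed_setOf_lintegral_le (X := E × E) (g := fun q ↦ nndist q.1 q.2 ^ 2)
      (by fun_prop) r
    simp only [ENNReal.coe_pow] at h
    simpa only [edist_nndist] using h
  refine (isCompact_setOf_lintegral_le hg hcompact
    (ENNReal.add_ne_top.2 ⟨hM, hr⟩)).of_isClosed_subset (h1.inter h2) ?_
  rintro π ⟨hπ1, hπ2⟩
  have : ∫⁻ q, ((‖q.1‖₊ ^ 2 + nndist q.1 q.2 ^ 2 : ℝ≥0) : ℝ≥0∞) ∂(π : Measure (E × E))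
      = ∫⁻ q, (‖q.1‖₊ : ℝ≥0∞) ^ 2 ∂(π : Measure (E × E))
        + ∫⁻ q, edist q.1 q.2 ^ 2 ∂(π : Measure (E × E)) := by
    rw [← lintegral_add_left (by fun_prop)]
    simp only [edist_nndist, ENNReal.coe_add, ENNReal.coe_pow]
  exact this.trans_le (add_le_add hπ1 hπ2)

/-- Pairs of probability measures at bounded transport cost, the first one having bounded second
moment, form a compact set. -/
lemma isCompact_setOf_transportCost2_le {M r : ℝ≥0∞} (hM : M ≠ ⊤) (hr : r ≠ ⊤) :
    IsCompact {p : ProbabilityMeasure E × ProbabilityMeasure E |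
      ∫⁻ x, (‖x‖₊ : ℝ≥0∞) ^ 2 ∂(p.1 : Measure E) ≤ M ∧
      transportCost2 (fun x y ↦ edist x y) (p.1 : Measure E) (p.2 : Measure E) ≤ r} := by
  have hsq : Measurable fun x : E ↦ (‖x‖₊ : ℝ≥0∞) ^ 2 := by fun_prop
  let Q : ℕ → Set (ProbabilityMeasure (E × E)) := fun n ↦ {π |
      ∫⁻ q, (‖q.1‖₊ : ℝ≥0∞) ^ 2 ∂(π : Measure (E × E)) ≤ M ∧
      ∫⁻ q, edist q.1 q.2 ^ 2 ∂(π : Measure (E × E)) ≤ r + ((n : ℝ≥0∞) + 1)⁻¹}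
  have hQ (n : ℕ) : IsCompact (Q n) :=
    isCompact_setOf_plan hM (ENNReal.add_ne_top.2 ⟨hr, by simp⟩)
  let T : ProbabilityMeasure (E × E) → ProbabilityMeasure E × ProbabilityMeasure E := fun π ↦
    (π.map continuous_fst.measurable.aemeasurable, π.map continuous_snd.measurable.aemeasurable)
  have hT : Continuous T := (ProbabilityMeasure.continuous_map continuous_fst).prodMk
    (ProbabilityMeasure.continuous_map continuous_snd)
  have key : {p : ProbabilityMeasure E × ProbabilityMeasure E |
      ∫⁻ x, (‖x‖₊ : ℝ≥0∞) ^ 2 ∂(p.1 : Measure E) ≤ M ∧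
      transportCost2 (fun x y ↦ edist x y) (p.1 : Measure E) (p.2 : Measure E) ≤ r}
      = ⋂ n, T '' Q n := by
    ext ⟨μ, ν⟩
    simp only [mem_ofPred_eq, mem_iInter]
    constructor
    · rintro ⟨h1, h2⟩ n
      obtain ⟨π, hπ, hlt⟩ := exists_isCoupling_of_transportCost2_lt
        (h2.trans_lt (ENNReal.lt_add_right hr (b := ((n : ℝ≥0∞) + 1)⁻¹) (by simp)))
      have hprob := hπ.isProbabilityMeasure
      refine ⟨⟨π, hprob⟩, ⟨?_, hlt.le⟩, Prod.ext (Subtype.ext hπ.1) (Subtype.ext hπ.2)⟩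
      rw [← hπ.1, lintegral_map hsq measurable_fst] at h1
      exact h1
    · intro h
      have hcpl (n : ℕ) : ∃ π ∈ Q n, IsCoupling (π : Measure (E × E)) (μ : Measure E) ν := by
        obtain ⟨π, hπ, hTπ⟩ := h n
        exact ⟨π, hπ, congrArg (fun p ↦ (p.1 : Measure E)) hTπ,
          congrArg (fun p ↦ (p.2 : Measure E)) hTπ⟩
      constructor
      · obtain ⟨π, hπ, hc⟩ := hcpl 0
        rw [← hc.1, lintegral_map hsq measurable_fst]
        exact hπ.1
      · have hlim : Tendsto (fun n : ℕ ↦ r + ((n : ℝ≥0∞) + 1)⁻¹) atTop (nhds r) := by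
          have h0 : Tendsto (fun n : ℕ ↦ ((n : ℝ≥0∞) + 1)⁻¹) atTop (nhds 0) := by
            have := (tendsto_add_atTop_iff_nat 1).2 ENNReal.tendsto_inv_nat_nhds_zero
            simpa using this
          simpa using tendsto_const_nhds (x := r).add h0
        refine ge_of_tendsto' hlim fun n ↦ ?_
        obtain ⟨π, hπ, hc⟩ := hcpl n
        exact (iInf₂_le (π : Measure (E × E)) hc).trans hπ.2
  rw [key]
  exact ((hQ 0).image hT).of_isClosed_subset
    (isClosed_iInter fun n ↦ ((hQ n).image hT).isClosed) (iInter_subset _ 0)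

lemma measurable_W2 {μ : Measure E} (hμ : MemP2 μ) : Measurable (W2 μ) := by
  obtain ⟨hprob, hM⟩ := hμ
  refine measurable_of_Iic fun a ↦ ?_
  by_cases ha : a = ⊤
  · simp [ha]
  let P : ProbabilityMeasure E := ⟨μ, hprob⟩
  have hcompact := (isCompact_setOf_transportCost2_le hM.ne
    (ENNReal.pow_ne_top (n := 2) ha)).inter_right ((isClosed_singleton (x := P)).preimage continuous_fst) |>.image continuous_snd
  have hemb : MeasurableEmbedding fun π : ProbabilityMeasure E ↦ (π : Measure E) :=
    MeasurableEmbedding.subtype_coe ProbabilityMeasure.measurableSet_isProbabilityMeasure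
  convert hemb.measurableSet_image' (measurableSet_of_isCompact_probabilityMeasure hcompact)
  ext ν
  simp only [mem_preimage, mem_Iic, mem_image]
  constructor
  · intro h
    have hν := isProbabilityMeasure_of_W2_ne_top (ne_top_of_le_ne_top ha h)
    exact ⟨⟨ν, hν⟩, ⟨(P, ⟨ν, hν⟩), ⟨⟨le_rfl, W2_le_iff.1 h⟩, rfl⟩, rfl⟩, rfl⟩
  · rintro ⟨-, ⟨⟨p, q⟩, ⟨⟨-, h⟩, hp⟩, rfl⟩, rfl⟩
    obtain rfl : p = P := hp
    exact W2_le_iff.2 h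

/-- The Wasserstein distance is weakly lower semicontinuous along sequences with bounded second
moments. -/
lemma W2_le_liminf {M : ℝ≥0∞} (hM : M ≠ ⊤) {μ : ℕ → ProbabilityMeasure E}
    {μ' : ProbabilityMeasure E} (hμ : ∀ n, ∫⁻ x, (‖x‖₊ : ℝ≥0∞) ^ 2 ∂(μ n : Measure E) ≤ M)
    (hlim : Tendsto μ atTop (nhds μ')) (ν : Measure E) :
    W2 (μ' : Measure E) ν ≤ liminf (fun n ↦ W2 (μ n : Measure E) ν) atTop := by
  refine le_of_forall_gt fun a ha ↦ ?_
  obtain ⟨b, hb, hba⟩ := exists_between ha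
  have hfreq := frequently_lt_of_liminf_lt (by isBoundedDefault) hb
  have hb_top : b ≠ ⊤ := ne_top_of_lt hba
  obtain ⟨n, hn⟩ := hfreq.exists
  have hν := isProbabilityMeasure_of_W2_ne_top (ne_top_of_lt hn)
  let N : ProbabilityMeasure E := ⟨ν, hν⟩
  have hclosed := (isCompact_setOf_transportCost2_le (E := E) hM
    (ENNReal.pow_ne_top (n := 2) hb_top)).isClosed
  have hmem := hclosed.mem_of_frequently_of_tendsto
    (f := fun n ↦ (μ n, N)) (hfreq.mono fun n hn ↦ ⟨hμ n, W2_le_iff.1 hn.le⟩)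
    (hlim.prodMk_nhds tendsto_const_nhds)
  exact (W2_le_iff.2 hmem.2).trans_lt hba

/-- A sequence in `P₂` with uniformly bounded second moments has a subsequence converging weakly
to an element of `P₂` satisfying the same bound. -/
lemma exists_subseq_tendsto_of_secondMoment_le {M : ℝ≥0∞} (hM : M ≠ ⊤)
    {μ : ℕ → ProbabilityMeasure E}
    (hμ : ∀ n, ∫⁻ x, (‖x‖₊ : ℝ≥0∞) ^ 2 ∂(μ n : Measure E) ≤ M) :
    ∃ μ' : ProbabilityMeasure E, ∫⁻ x, (‖x‖₊ : ℝ≥0∞) ^ 2 ∂(μ' : Measure E) ≤ M ∧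
      ∃ φ : ℕ → ℕ, StrictMono φ ∧ Tendsto (μ ∘ φ) atTop (nhds μ') := by
  have hcompact (n : ℕ) : IsCompact {x : E | ‖x‖₊ ^ 2 ≤ (n : ℝ≥0)} := by
    refine (isCompact_closedBall (0 : E) (n + 1)).of_isClosed_subset
      (isClosed_le (by fun_prop) continuous_const) fun x hx ↦ ?_
    have hx' : ‖x‖ ^ 2 ≤ n := by exact_mod_cast hx
    rw [mem_closedBall_zero_iff]
    nlinarith [norm_nonneg x]
  have := isCompact_setOf_lintegral_le (X := E) (g := fun x ↦ ‖x‖₊ ^ 2) (by fun_prop) hcompact hM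
  simp only [ENNReal.coe_pow] at this
  exact this.tendsto_subseq hμ

end Wasserstein

/-- Existence of a Wasserstein median.
If `Λ` is a probability measure on `P₂(ℝᵈ)` such that the functional
`F ν = ∫ W₂(ν, λ) dΛ(λ)` is not identically infinite on `P₂(ℝᵈ)`, then `F` admits a
minimizer over `P₂(ℝᵈ)`. -/
theorem wasserstein_median_exists {d : ℕ} (Λ : Measure (Measure (Rd d)))
    (hΛ : IsProbabilityMeasure Λ) (hsupp : Λ {μ : Measure (Rd d) | ¬ MemP2 μ} = 0)
    (hfin : ∃ ν : Measure (Rd d), MemP2 ν ∧ (∫⁻ μ, W2 ν μ ∂Λ) ≠ ⊤) :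
    ∃ νstar : Measure (Rd d), MemP2 νstar ∧
      (∫⁻ μ, W2 νstar μ ∂Λ) =
        ⨅ ν ∈ {ν : Measure (Rd d) | MemP2 ν}, ∫⁻ μ, W2 ν μ ∂Λ := by
  have hΛ' : ∀ᵐ μ ∂Λ, MemP2 μ := hsupp
  set I : ℝ≥0∞ := ⨅ ν ∈ {ν : Measure (Rd d) | MemP2 ν}, ∫⁻ μ, W2 ν μ ∂Λ with hI
  have hI_top : I ≠ ⊤ := by
    obtain ⟨ν, hν, h⟩ := hfin
    exact ne_top_of_le_ne_top h (iInf₂_le ν hν)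
  have hseq (n : ℕ) : ∃ ν : Measure (Rd d), MemP2 ν ∧
      ∫⁻ μ, W2 ν μ ∂Λ < I + ((n + 1 : ℕ) : ℝ≥0∞)⁻¹ := by
    have h := ENNReal.lt_add_right hI_top (b := ((n + 1 : ℕ) : ℝ≥0∞)⁻¹) (by simp)
    rw [hI] at h
    simp only [iInf_lt_iff] at h
    obtain ⟨ν, hν, h⟩ := h
    exact ⟨ν, hν, h⟩
  choose ν hν hνI using hseq
  obtain ⟨M, hM, hbound⟩ := exists_secondMoment_le hΛ' (C := I + 1)
    (ENNReal.add_ne_top.2 ⟨hI_top, by simp⟩)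
  have hνM (n : ℕ) : ∫⁻ x, (‖x‖₊ : ℝ≥0∞) ^ 2 ∂(ν n) ≤ M := by
    refine hbound _ ((hνI n).le.trans ?_)
    gcongr
    rw [ENNReal.inv_le_one]
    exact_mod_cast Nat.succ_pos n
  obtain ⟨νstar, hstar, φ, hφ, hlim⟩ := exists_subseq_tendsto_of_secondMoment_le hM
    (μ := fun n ↦ ⟨ν n, (hν n).1⟩) hνM
  have hstarP2 : MemP2 (νstar : Measure (Rd d)) := ⟨νstar.2, hstar.trans_lt hM.lt_top⟩
  refine ⟨νstar, hstarP2, le_antisymm ?_ (iInf₂_le _ hstarP2)⟩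
  have hFlim : Tendsto (fun n ↦ ∫⁻ μ, W2 (ν n) μ ∂Λ) atTop (nhds I) := by
    refine tendsto_of_tendsto_of_tendsto_of_le_of_le tendsto_const_nhds ?_
      (fun n ↦ iInf₂_le _ (hν n)) fun n ↦ (hνI n).le
    simpa only [add_zero] using (tendsto_const_nhds (x := I)).add
      ((tendsto_add_atTop_iff_nat 1).2 ENNReal.tendsto_inv_nat_nhds_zero)
  calc ∫⁻ μ, W2 (νstar : Measure (Rd d)) μ ∂Λ
      ≤ ∫⁻ μ, liminf (fun n ↦ W2 (ν (φ n)) μ) atTop ∂Λ :=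
        lintegral_mono fun μ ↦ W2_le_liminf hM
          (μ := (fun n ↦ ⟨ν n, (hν n).1⟩) ∘ φ) (fun n ↦ hνM (φ n)) hlim μ
    _ ≤ liminf (fun n ↦ ∫⁻ μ, W2 (ν (φ n)) μ ∂Λ) atTop :=
        lintegral_liminf_le fun n ↦ measurable_W2 (hν (φ n))
    _ = I := (hFlim.comp hφ.tendsto_atTop).liminf_eq
end
end

section
/- Let μ₁, …, μ_N ∈ P₂(ℝᵈ) be absolutely continuous with respect to the Lebesgue measure, with weights π₁, …, π_N > 0 summing to 1, and F(ν) = Σ_{n=1}^N π_n W₂(ν, μ_n). Suppose ν⁽ᵗ⁾ ∈ P₂(ℝᵈ) satisfies W₂(ν⁽ᵗ⁾, μ_n) > 0 for all n, and let ν⁽ᵗ⁺¹⁾ be the minimizer of G_t(ν) = Σ_{n=1}^N (π_n / W₂(ν⁽ᵗ⁾, μ_n)) W₂²(ν, μ_n). Then F(ν⁽ᵗ⁺¹⁾) ≤ F(ν⁽ᵗ⁾), i.e., the IRLS update never increases the Wasserstein median objective; moreover equality holds if W₂(ν⁽ᵗ⁾, μ_n) = W₂(ν⁽ᵗ⁺¹⁾,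 μ_n) for all n. -/
open MeasureTheory Filter Set
open scoped ENNReal NNReal

noncomputable section

/-- Young's inequality in the form used for quadratic majorization of the identity. -/
theorem ENNReal.two_mul_le_inv_mul_sq_add {a : ℝ≥0∞} (ha0 : a ≠ 0) (ha : a ≠ ⊤) (b : ℝ≥0∞) :
    2 * b ≤ a⁻¹ * b ^ 2 + a := by
  obtain rfl | hb := eq_or_ne b ⊤
  · simp [ENNReal.mul_top (ENNReal.inv_ne_zero.2 ha)]
  lift a to ℝ≥0 using ha
  lift b to ℝ≥0 using hb
  have ha0' : a ≠ 0 := by exact_mod_cast ha0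
  rw [← ENNReal.coe_inv ha0']
  norm_cast
  rw [← NNReal.coe_le_coe]
  push_cast
  have hpos : (0 : ℝ) < a := by positivity
  have hsq : (a : ℝ)⁻¹ * b ^ 2 + a - 2 * b = (b - a) ^ 2 / a := by
    field_simp
    ring
  have hnonneg : 0 ≤ ((b : ℝ) - a) ^ 2 / a := by positivity
  linarith

/-- One step of iteratively reweighted least squares does not increase a weighted sum. -/
theorem ENNReal.sum_mul_le_sum_mul_of_sum_div_mul_sq_le {ι : Type*} (s : Finset ι)
    (w a b : ι → ℝ≥0∞) (hw : ∀ i ∈ s, w i ≠ 0) (ha : ∀ i ∈ s, a i ≠ 0)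
    (h : ∑ i ∈ s, w i / a i * b i ^ 2 ≤ ∑ i ∈ s, w i / a i * a i ^ 2) :
    ∑ i ∈ s, w i * b i ≤ ∑ i ∈ s, w i * a i := by
  by_cases htop : ∃ i ∈ s, a i = ⊤
  · obtain ⟨i, hi, hia⟩ := htop
    have hsum : ∑ i ∈ s, w i * a i = ⊤ :=
      ENNReal.sum_eq_top.2 ⟨i, hi, by rw [hia, ENNReal.mul_top (hw i hi)]⟩
    exact hsum ▸ le_top
  push Not at htop
  have hself : ∑ i ∈ s, w i / a i * a i ^ 2 = ∑ i ∈ s, w i * a i :=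
    Finset.sum_congr rfl fun i hi ↦ by
      rw [pow_two, ← mul_assoc, ENNReal.div_mul_cancel (ha i hi) (htop i hi)]
  refine (ENNReal.mul_le_mul_iff_right two_ne_zero ENNReal.ofNat_ne_top).1 ?_
  calc 2 * ∑ i ∈ s, w i * b i
      = ∑ i ∈ s, w i * (2 * b i) := by
        rw [Finset.mul_sum]
        exact Finset.sum_congr rfl fun i _ ↦ by ring
    _ ≤ ∑ i ∈ s, (w i / a i * b i ^ 2 + w i * a i) := Finset.sum_le_sum fun i hi ↦ by
        rw [div_eq_mul_inv, mul_assoc, ← mul_add]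
        exact mul_le_mul_right (two_mul_le_inv_mul_sq_add (ha i hi) (htop i hi) (b i)) _
    _ ≤ ∑ i ∈ s, w i * a i + ∑ i ∈ s, w i * a i := by
        rw [Finset.sum_add_distrib]
        exact add_le_add_left (h.trans_eq hself) _
    _ = 2 * ∑ i ∈ s, w i * a i := (two_mul _).symm

/-- The IRLS update never increases the Wasserstein median objective.
If `ν⁽ᵗ⁺¹⁾` minimizes `G_t(ν) = Σₙ (πₙ / W₂(ν⁽ᵗ⁾, μₙ)) W₂²(ν, μₙ)` over `P₂(ℝᵈ)`,
then `F(ν⁽ᵗ⁺¹⁾) ≤ F(ν⁽ᵗ⁾)`, with equality if `W₂(ν⁽ᵗ⁾, μₙ) = W₂(ν⁽ᵗ⁺¹⁾, μₙ)` for all `n`. -/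
theorem irls_descent {d N : ℕ}
    (μ : Fin N → Measure (Rd d)) (π : Fin N → ℝ)
    (hμ : ∀ n, MemP2 (μ n)) (hac : ∀ n, μ n ≪ (volume : Measure (Rd d)))
    (hπ : ∀ n, 0 < π n) (hπsum : ∑ n, π n = 1)
    (νt νt1 : Measure (Rd d)) (hνt : MemP2 νt)
    (hpos : ∀ n, W2 νt (μ n) ≠ 0)
    (hνt1 : MemP2 νt1)
    (hmin : ∀ ρ : Measure (Rd d), MemP2 ρ →
      (∑ n, ENNReal.ofReal (π n) / W2 νt (μ n) * W2 νt1 (μ n) ^ 2) ≤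
        ∑ n, ENNReal.ofReal (π n) / W2 νt (μ n) * W2 ρ (μ n) ^ 2) :
    (∑ n, ENNReal.ofReal (π n) * W2 νt1 (μ n)) ≤
      (∑ n, ENNReal.ofReal (π n) * W2 νt (μ n)) ∧
    ((∀ n, W2 νt (μ n) = W2 νt1 (μ n)) →
      (∑ n, ENNReal.ofReal (π n) * W2 νt1 (μ n)) =
        ∑ n, ENNReal.ofReal (π n) * W2 νt (μ n)) := by
  refine ⟨ENNReal.sum_mul_le_sum_mul_of_sum_div_mul_sq_le _ _ _ _
    (fun n _ ↦ (ENNReal.ofReal_pos.2 (hπ n)).ne') (fun n _ ↦ hpos n) (hmin νt hνt), fun h ↦ ?_⟩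
  simp only [h]
end
end

section
/- Let μ₁, …, μ_N ∈ P₂(ℝᵈ) be absolutely continuous with respect to the Lebesgue measure, with weights π₁, …, π_N > 0 summing to 1. The updating map U : ν ↦ argmin_ρ Σ_{n=1}^N (π_n / W₂(ν, μ_n)) W₂²(ρ, μ_n) is continuous with respect to W₂ on the set of ν ∈ P₂(ℝᵈ) with W₂(ν, μ_n) > 0 for all n: for every such ν and every ε > 0 there exists δ > 0 such that W₂(ν, ν') < δ implies W₂(U(ν), U(ν')) < ε. -/
open MeasureTheory Filter Set
open scoped ENNReal NNReal

noncomputable section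

open scoped Topology ProbabilityTheory

section Coupling

variable {α : Type*} [MeasurableSpace α]

lemma IsCoupling.lintegral_fst {μ ν : Measure α} {P : Measure (α × α)} (h : IsCoupling P μ ν)
    {f : α → ℝ≥0∞} (hf : Measurable f) : ∫⁻ q, f q.1 ∂P = ∫⁻ x, f x ∂μ := by
  rw [← h.1, lintegral_map hf measurable_fst]

lemma IsCoupling.lintegral_snd {μ ν : Measure α} {P : Measure (α × α)} (h : IsCoupling P μ ν)
    {f : α → ℝ≥0∞} (hf : Measurable f) : ∫⁻ q, f q.2 ∂P = ∫⁻ x, f x ∂ν := by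
  rw [← h.2, lintegral_map hf measurable_snd]

lemma IsCoupling.isProbabilityMeasure_s4 {μ ν : Measure α} [IsProbabilityMeasure μ]
    {P : Measure (α × α)} (h : IsCoupling P μ ν) : IsProbabilityMeasure P := by
  have : IsProbabilityMeasure (P.map Prod.fst) := by rw [h.1]; infer_instance
  exact Measure.isProbabilityMeasure_of_map Prod.fst

lemma IsCoupling.add {μ ν μ' ν' : Measure α} {P Q : Measure (α × α)}
    (hP : IsCoupling P μ ν) (hQ : IsCoupling Q μ' ν') : IsCoupling (P + Q) (μ + μ') (ν + ν') := by
  constructor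
  · rw [Measure.map_add _ _ measurable_fst, hP.1, hQ.1]
  · rw [Measure.map_add _ _ measurable_snd, hP.2, hQ.2]

lemma exists_isCoupling (μ ν : Measure α) [IsFiniteMeasure μ] [IsFiniteMeasure ν]
    (h : μ univ = ν univ) : ∃ P, IsCoupling P μ ν := by
  by_cases h0 : μ univ = 0
  · have h0' : ν univ = 0 := h ▸ h0
    rw [Measure.measure_univ_eq_zero] at h0 h0'
    subst h0 h0'
    exact ⟨0, by simp [IsCoupling]⟩
  · refine ⟨(μ univ)⁻¹ • μ.prod ν, ?_, ?_⟩
    · rw [Measure.map_smul, Measure.map_fst_prod, ← h, smul_smul,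
        ENNReal.inv_mul_cancel h0 (measure_ne_top _ _), one_smul]
    · rw [Measure.map_smul, Measure.map_snd_prod, smul_smul,
        ENNReal.inv_mul_cancel h0 (measure_ne_top _ _), one_smul]

variable [EDist α]

lemma W2_sq (μ ν : Measure α) :
    W2 μ ν ^ 2 = transportCost2 (fun x y => edist x y) μ ν := by
  rw [W2, wasserstein2, ← ENNReal.rpow_natCast, ← ENNReal.rpow_mul]
  norm_num

lemma IsCoupling.W2_sq_le {μ ν : Measure α} {P : Measure (α × α)} (h : IsCoupling P μ ν) :
    W2 μ ν ^ 2 ≤ ∫⁻ q, edist q.1 q.2 ^ 2 ∂P := by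
  rw [W2_sq]
  exact iInf₂_le P h

lemma exists_isCoupling_lt {μ ν : Measure α} {r : ℝ≥0∞} (h : W2 μ ν ^ 2 < r) :
    ∃ P, IsCoupling P μ ν ∧ ∫⁻ q, edist q.1 q.2 ^ 2 ∂P < r := by
  rw [W2_sq, transportCost2] at h
  simpa only [iInf_lt_iff, exists_prop, mem_ofPred_eq] using h

lemma W2_le_of_sq_le {μ ν : Measure α} {r : ℝ≥0∞} (h : W2 μ ν ^ 2 ≤ r ^ 2) : W2 μ ν ≤ r :=
  (ENNReal.pow_le_pow_left_iff two_ne_zero).1 h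

end Coupling

section Norm

variable {E : Type*} [NormedAddCommGroup E]

lemma enorm_add_sq_le (x y : E) : ‖x + y‖ₑ ^ 2 ≤ 2 * (‖x‖ₑ ^ 2 + ‖y‖ₑ ^ 2) := by
  calc ‖x + y‖ₑ ^ 2 ≤ (‖x‖ₑ + ‖y‖ₑ) ^ 2 := by gcongr; exact enorm_add_le _ _
    _ ≤ 2 * (‖x‖ₑ ^ 2 + ‖y‖ₑ ^ 2) := by
      simp only [enorm]
      norm_cast
      exact add_sq_le

lemma edist_sq_le (x y : E) : edist x y ^ 2 ≤ 2 * (‖x‖ₑ ^ 2 + ‖y‖ₑ ^ 2) := by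
  have := enorm_add_sq_le x (-y)
  rwa [enorm_neg, ← sub_eq_add_neg, ← edist_eq_enorm_sub] at this

lemma enorm_sq_le (x y : E) : ‖x‖ₑ ^ 2 ≤ 2 * (edist x y ^ 2 + ‖y‖ₑ ^ 2) := by
  have := enorm_add_sq_le (x - y) y
  rwa [sub_add_cancel, ← edist_eq_enorm_sub] at this

lemma enorm_prod_sq_le (q : E × E) : ‖q‖ₑ ^ 2 ≤ 2 * edist q.1 q.2 ^ 2 + 3 * ‖q.2‖ₑ ^ 2 := by
  have h : ‖q‖ₑ ^ 2 ≤ ‖q.1‖ₑ ^ 2 + ‖q.2‖ₑ ^ 2 := by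
    simp only [enorm_eq_nnnorm, Prod.nnnorm_def, ENNReal.coe_max]
    rcases max_cases (‖q.1‖₊ : ℝ≥0∞) ‖q.2‖₊ with h | h <;> rw [h.1] <;> simp
  calc ‖q‖ₑ ^ 2 ≤ 2 * (edist q.1 q.2 ^ 2 + ‖q.2‖ₑ ^ 2) + ‖q.2‖ₑ ^ 2 :=
        h.trans (add_le_add_left (enorm_sq_le _ _) _)
    _ = 2 * edist q.1 q.2 ^ 2 + 3 * ‖q.2‖ₑ ^ 2 := by ring

end Norm

section Wasserstein

variable {E : Type*} [NormedAddCommGroup E] [MeasurableSpace E] [BorelSpace E]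

lemma IsCoupling.lintegral_edist_sq_le {μ ν : Measure E} {P : Measure (E × E)}
    (h : IsCoupling P μ ν) :
    ∫⁻ q, edist q.1 q.2 ^ 2 ∂P ≤ 2 * (∫⁻ x, ‖x‖ₑ ^ 2 ∂μ + ∫⁻ x, ‖x‖ₑ ^ 2 ∂ν) := by
  rw [← h.lintegral_fst (by fun_prop), ← h.lintegral_snd (by fun_prop),
    ← lintegral_add_left (by fun_prop), ← lintegral_const_mul _ (by fun_prop)]
  exact lintegral_mono fun q => edist_sq_le _ _

lemma MemP2.W2_ne_top {μ ν : Measure E} (hμ : MemP2 μ) (hν : MemP2 ν) : W2 μ ν ≠ ⊤ := by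
  have := hμ.1
  have := hν.1
  obtain ⟨P, hP⟩ := exists_isCoupling μ ν (by simp)
  have h : W2 μ ν ^ 2 < ⊤ := (hP.W2_sq_le.trans hP.lintegral_edist_sq_le).trans_lt
    (ENNReal.mul_lt_top (by simp) (ENNReal.add_lt_top.2 ⟨hμ.2, hν.2⟩))
  intro ht
  simp [ht] at h

variable [SecondCountableTopology E]

lemma W2_comm (μ ν : Measure E) : W2 μ ν = W2 ν μ := by
  suffices ∀ μ ν : Measure E, W2 μ ν ≤ W2 ν μ from le_antisymm (this _ _) (this _ _)
  intro μ ν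
  refine W2_le_of_sq_le ?_
  refine le_of_forall_gt fun r hr => ?_
  obtain ⟨P, hP, hlt⟩ := exists_isCoupling_lt hr
  have hQ : IsCoupling (P.map Prod.swap) μ ν := by
    constructor
    · rw [Measure.map_map measurable_fst measurable_swap]; exact hP.2
    · rw [Measure.map_map measurable_snd measurable_swap]; exact hP.1
  refine hQ.W2_sq_le.trans_lt ?_
  rw [lintegral_map (by fun_prop) measurable_swap]
  simpa [edist_comm] using hlt

variable [CompleteSpace E]

/-- Gluing of two couplings along their common marginal. -/
lemma exists_glue {μ ν ρ : Measure E} {P Q : Measure (E × E)} [IsFiniteMeasure P]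
    [IsFiniteMeasure Q] (hP : IsCoupling P μ ν) (hQ : IsCoupling Q ν ρ) :
    ∃ S : Measure ((E × E) × E), S.map Prod.fst = P ∧ S.map (fun q => (q.1.2, q.2)) = Q := by
  refine ⟨P ⊗ₘ (Q.condKernel.comap Prod.snd measurable_snd), ?_, ?_⟩
  · exact Measure.fst_compProd _ _
  · refine Measure.ext_of_lintegral _ fun f hf => ?_
    have hfst : Q.fst = P.map Prod.snd := hQ.1.trans hP.2.symm
    conv_rhs => rw [← Q.disintegrate Q.condKernel]
    rw [lintegral_map hf (by fun_prop), Measure.lintegral_compProd (by fun_prop),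
      Measure.lintegral_compProd hf, hfst,
      lintegral_map (Measurable.lintegral_kernel_prod_right' hf) measurable_snd]
    rfl

lemma W2_triangle (μ ν ρ : Measure E) [IsProbabilityMeasure μ] [IsProbabilityMeasure ν] :
    W2 μ ρ ≤ W2 μ ν + W2 ν ρ := by
  have key : ∀ P Q : Measure (E × E), IsCoupling P μ ν → IsCoupling Q ν ρ →
      W2 μ ρ ≤ (∫⁻ q, edist q.1 q.2 ^ 2 ∂P) ^ (1 / 2 : ℝ) +
        (∫⁻ q, edist q.1 q.2 ^ 2 ∂Q) ^ (1 / 2 : ℝ) := by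
    intro P Q hP hQ
    have := hP.isProbabilityMeasure_s4
    have := hQ.isProbabilityMeasure_s4
    obtain ⟨S, hRP, hRQ⟩ := exists_glue hP hQ
    have hR : IsCoupling (S.map fun q => (q.1.1, q.2)) μ ρ := by
      constructor
      · rw [Measure.map_map measurable_fst (by fun_prop), ← hP.1, ← hRP,
          Measure.map_map measurable_fst measurable_fst]
        rfl
      · rw [Measure.map_map measurable_snd (by fun_prop), ← hQ.2, ← hRQ,
          Measure.map_map measurable_snd (by fun_prop)]
        rfl
    have hle : W2 μ ρ ≤
        (∫⁻ q : (E × E) × E, edist q.1.1 q.2 ^ 2 ∂S) ^ (1 / 2 : ℝ) := by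
      refine W2_le_of_sq_le ?_
      refine hR.W2_sq_le.trans_eq ?_
      rw [lintegral_map (by fun_prop) (by fun_prop), ← ENNReal.rpow_natCast, ← ENNReal.rpow_mul]
      norm_num
    refine hle.trans ?_
    rw [← hRP, ← hRQ, lintegral_map (by fun_prop) (by fun_prop),
      lintegral_map (by fun_prop) (by fun_prop)]
    have hmink := ENNReal.lintegral_Lp_add_le (μ := S) (p := 2)
      (f := fun q => edist q.1.1 q.1.2) (g := fun q => edist q.1.2 q.2)
      (by fun_prop) (by fun_prop) (by norm_num)
    simp only [ENNReal.rpow_two] at hmink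
    refine le_trans ?_ hmink
    gcongr with q
    exact edist_triangle _ _ _
  have hsqrt : ∀ {μ ν : Measure E} {r : ℝ≥0∞}, W2 μ ν < r → ∃ P, IsCoupling P μ ν ∧
      (∫⁻ q, edist q.1 q.2 ^ 2 ∂P) ^ (1 / 2 : ℝ) < r := by
    intro μ ν r h
    obtain ⟨P, hP, hlt⟩ := exists_isCoupling_lt (ENNReal.pow_lt_pow_left two_ne_zero h)
    refine ⟨P, hP, ?_⟩
    calc _ < (r ^ 2) ^ (1 / 2 : ℝ) := ENNReal.rpow_lt_rpow hlt (by norm_num)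
      _ = r := by rw [← ENNReal.rpow_natCast, ← ENNReal.rpow_mul]; norm_num
  refine ENNReal.le_of_forall_pos_le_add fun ε hε hfin => ?_
  obtain ⟨h1, h2⟩ := ENNReal.add_lt_top.1 hfin
  have hε' : ((ε : ℝ≥0∞) / 2) ≠ 0 := by simp [hε.ne']
  obtain ⟨P, hP, hPlt⟩ := hsqrt (ENNReal.lt_add_right h1.ne hε')
  obtain ⟨Q, hQ, hQlt⟩ := hsqrt (ENNReal.lt_add_right h2.ne hε')
  calc W2 μ ρ ≤ _ := key P Q hP hQ
    _ ≤ (W2 μ ν + ε / 2) + (W2 ν ρ + ε / 2) := add_le_add hPlt.le hQlt.le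
    _ = W2 μ ν + W2 ν ρ + ε := by
      rw [add_add_add_comm, ENNReal.add_halves]

end Wasserstein

section WeakConvergence

variable {Ω ι : Type*} [MeasurableSpace Ω] [TopologicalSpace Ω] [OpensMeasurableSpace Ω]

lemma lintegral_le_of_tendsto_of_eventually_le {F : Filter ι} [F.NeBot]
    {Ps : ι → ProbabilityMeasure Ω} {P : ProbabilityMeasure Ω} (hP : Tendsto Ps F (𝓝 P))
    {f : Ω → ℝ≥0} (hf : Continuous f) {a : ι → ℝ≥0∞} {c : ℝ≥0∞} (ha : Tendsto a F (𝓝 c))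
    (h : ∀ᶠ i in F, ∫⁻ x, f x ∂(Ps i : Measure Ω) ≤ a i) :
    ∫⁻ x, f x ∂(P : Measure Ω) ≤ c := by
  have hsup : ∀ x, (f x : ℝ≥0∞) = ⨆ n : ℕ, ((min (f x) n : ℝ≥0) : ℝ≥0∞) := by
    intro x
    refine le_antisymm ?_ (iSup_le fun n => by gcongr; exact min_le_left _ _)
    obtain ⟨n, hn⟩ := exists_nat_ge (f x)
    exact le_iSup_of_le n (by rw [min_eq_left hn])
  simp_rw [hsup]
  rw [lintegral_iSup (fun n => by fun_prop)
    (fun m n hmn x => by simp only; gcongr)]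
  refine iSup_le fun n => ?_
  let g : BoundedContinuousFunction Ω ℝ≥0 :=
    BoundedContinuousFunction.mkOfBound ⟨fun x => min (f x) n, by fun_prop⟩ n fun x y => by
        rw [NNReal.dist_eq, ← NNReal.coe_natCast]
        exact abs_sub_le_of_nonneg_of_le (NNReal.coe_nonneg _)
          (NNReal.coe_le_coe.2 (min_le_right _ _)) (NNReal.coe_nonneg _)
          (NNReal.coe_le_coe.2 (min_le_right _ _))
  refine le_of_tendsto_of_tendsto
    (ProbabilityMeasure.tendsto_iff_forall_lintegral_tendsto.1 hP g) ha ?_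
  filter_upwards [h] with i hi
  refine le_trans (lintegral_mono fun x => ?_) hi
  exact ENNReal.coe_le_coe.2 (min_le_left _ _)

/-- Generalized dominated convergence for weakly convergent probability measures. -/
lemma tendsto_lintegral_of_le {F : Filter ι}
    {Ps : ι → ProbabilityMeasure Ω} {P : ProbabilityMeasure Ω} (hP : Tendsto Ps F (𝓝 P))
    {f h : Ω → ℝ≥0} (hf : Continuous f) (hh : Continuous h) (hfh : ∀ x, f x ≤ h x)
    (hfin : ∫⁻ x, h x ∂(P : Measure Ω) ≠ ⊤)
    (hlim : Tendsto (fun i => ∫⁻ x, h x ∂(Ps i : Measure Ω)) F (𝓝 (∫⁻ x, h x ∂(P : Measure Ω)))) :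
    Tendsto (fun i => ∫⁻ x, f x ∂(Ps i : Measure Ω)) F (𝓝 (∫⁻ x, f x ∂(P : Measure Ω))) := by
  rw [tendsto_iff_ultrafilter]
  intro G hG
  have hPG := hP.mono_left hG
  have hsplit : ∀ Q : Measure Ω, ∫⁻ x, f x ∂Q + ∫⁻ x, (h x - f x : ℝ≥0) ∂Q = ∫⁻ x, h x ∂Q := by
    intro Q
    rw [← lintegral_add_left (by fun_prop)]
    refine lintegral_congr fun x => ?_
    rw [← ENNReal.coe_add, add_tsub_cancel_of_le (hfh x)]
  have hcv : ∀ k : Ω → ℝ≥0,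
      ∃ u, Tendsto (fun i => ∫⁻ x, k x ∂(Ps i : Measure Ω)) G (𝓝 u) := fun k =>
    ⟨_, (G.map (fun i => ∫⁻ x, k x ∂(Ps i : Measure Ω))).le_nhds_lim⟩
  obtain ⟨u, hu⟩ := hcv f
  obtain ⟨v, hv⟩ := hcv fun x => h x - f x
  have hu' := lintegral_le_of_tendsto_of_eventually_le hPG hf hu (.of_forall fun _ => le_rfl)
  have hv' := lintegral_le_of_tendsto_of_eventually_le hPG
    (f := fun x => h x - f x) (by fun_prop) hv (.of_forall fun _ => le_rfl)
  have huv : u + v = ∫⁻ x, h x ∂(P : Measure Ω) := by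
    refine tendsto_nhds_unique ?_ (hlim.mono_left hG)
    simpa only [hsplit] using hu.add hv
  rw [← hsplit] at huv hfin
  have hle : u ≤ ∫⁻ x, f x ∂(P : Measure Ω) := by
    refine (ENNReal.add_le_add_iff_right (ENNReal.add_ne_top.1 hfin).2).1 ?_
    calc _ ≤ u + v := by gcongr
      _ = _ := huv
  rwa [le_antisymm hu' hle]

lemma isCompact_closure_setOf_lintegral_enorm_sq_le {E : Type*} [NormedAddCommGroup E]
    [ProperSpace E] [MeasurableSpace E] [BorelSpace E] {C : ℝ≥0∞} (hC : C ≠ ⊤) :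
    IsCompact (closure {P : ProbabilityMeasure E | ∫⁻ x, ‖x‖ₑ ^ 2 ∂(P : Measure E) ≤ C}) := by
  refine isCompact_closure_of_isTightMeasureSet ?_
  rw [isTightMeasureSet_iff_exists_isCompact_measure_compl_le]
  intro ε hε
  obtain ⟨n, hn⟩ := ENNReal.exists_nat_mul_gt hε.ne' hC
  refine ⟨Metric.closedBall 0 n, isCompact_closedBall _ _, ?_⟩
  rintro _ ⟨P, hP, rfl⟩
  have hn0 : n ≠ 0 := by rintro rfl; simp at hn
  have hsub : (Metric.closedBall (0 : E) n)ᶜ ⊆ {x | (n : ℝ≥0∞) ≤ ‖x‖ₑ ^ 2} := by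
    intro x hx
    simp only [mem_compl_iff, mem_closedBall_zero_iff, not_le] at hx
    have h1 : (n : ℝ≥0∞) ≤ ‖x‖ₑ := by
      rw [enorm_eq_nnnorm]
      exact_mod_cast hx.le
    calc (n : ℝ≥0∞) ≤ (n : ℝ≥0∞) ^ 2 := by exact_mod_cast Nat.le_self_pow two_ne_zero n
      _ ≤ _ := by gcongr
  have hmul : (n : ℝ≥0∞) * (P : Measure E) (Metric.closedBall (0 : E) n)ᶜ ≤ n * ε :=
    calc _ ≤ (n : ℝ≥0∞) * (P : Measure E) {x | (n : ℝ≥0∞) ≤ ‖x‖ₑ ^ 2} := by gcongr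
      _ ≤ ∫⁻ x, ‖x‖ₑ ^ 2 ∂(P : Measure E) := mul_meas_ge_le_lintegral (by fun_prop) _
      _ ≤ C := hP
      _ ≤ n * ε := hn.le
  exact (ENNReal.mul_le_mul_iff_right (by exact_mod_cast hn0) (by simp)).1 hmul

end WeakConvergence

section Discretization

variable {E : Type*} [NormedAddCommGroup E] [MeasurableSpace E] [BorelSpace E]
  [SecondCountableTopology E] {ι : Type*}

lemma W2_sum_smul_dirac_sq_le [Fintype ι] (x : ι → E) (p q : ι → ℝ≥0∞) (h : ∑ i, p i = ∑ i, q i)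
    (hfin : ∑ i, p i ≠ ⊤) :
    W2 (∑ i, p i • Measure.dirac (x i)) (∑ i, q i • Measure.dirac (x i)) ^ 2 ≤
      2 * (∑ i, (p i - q i) * ‖x i‖ₑ ^ 2 + ∑ i, (q i - p i) * ‖x i‖ₑ ^ 2) := by
  have hp : ∀ i, p i ≠ ⊤ := by simpa [ENNReal.sum_eq_top] using hfin
  have hq : ∀ i, q i ≠ ⊤ := by simpa [h, ENNReal.sum_eq_top] using hfin
  have hfinite : ∀ r : ι → ℝ≥0∞, (∀ i, r i ≠ ⊤) →
      IsFiniteMeasure (∑ i, r i • Measure.dirac (x i)) := fun r hr =>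
    ⟨by simpa [ENNReal.sum_lt_top, lt_top_iff_ne_top] using hr⟩
  have := hfinite (fun i => p i - q i) fun i => ENNReal.sub_ne_top (hp i)
  have := hfinite (fun i => q i - p i) fun i => ENNReal.sub_ne_top (hq i)
  obtain ⟨Q, hQ⟩ := exists_isCoupling (∑ i, (p i - q i) • Measure.dirac (x i))
    (∑ i, (q i - p i) • Measure.dirac (x i)) (by
      have hmin : ∑ i, min (p i) (q i) ≠ ⊤ :=
        ne_top_of_le_ne_top hfin (Finset.sum_le_sum fun i _ => min_le_left _ _)
      have h1 : ∑ i, (p i - q i) + ∑ i, min (p i) (q i) = ∑ i, p i := by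
        rw [← Finset.sum_add_distrib]
        exact Finset.sum_congr rfl fun i _ => tsub_add_min
      have h2 : ∑ i, (q i - p i) + ∑ i, min (p i) (q i) = ∑ i, q i := by
        rw [← Finset.sum_add_distrib]
        exact Finset.sum_congr rfl fun i _ => by rw [min_comm, tsub_add_min]
      have h3 := (ENNReal.add_left_inj hmin).1 (h1.trans (h.trans h2.symm))
      simpa using h3)
  have hD : IsCoupling (∑ i, min (p i) (q i) • Measure.dirac (x i, x i))
      (∑ i, min (p i) (q i) • Measure.dirac (x i))
      (∑ i, min (p i) (q i) • Measure.dirac (x i)) := by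
    constructor
    · rw [Measure.map_finset_sum (by fun_prop)]
      simp [Measure.map_dirac]
    · rw [Measure.map_finset_sum (by fun_prop)]
      simp [Measure.map_dirac]
  have hsum : ∀ r s : ι → ℝ≥0∞, ∑ i, (r i - s i) • Measure.dirac (x i) +
      ∑ i, min (r i) (s i) • Measure.dirac (x i) = ∑ i, r i • Measure.dirac (x i) := by
    intro r s
    simp only [← Finset.sum_add_distrib, ← add_smul, tsub_add_min]
  have hadd := hQ.add hD
  rw [hsum p q] at hadd
  simp only [min_comm (p _) (q _)] at hadd
  rw [hsum q p] at hadd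
  refine hadd.W2_sq_le.trans ?_
  rw [lintegral_add_measure]
  have h0 : ∫⁻ z, edist z.1 z.2 ^ 2 ∂(∑ i, min (q i) (p i) • Measure.dirac (x i, x i)) = 0 := by
    rw [lintegral_finsetSum_measure]
    simp
  rw [h0, add_zero]
  refine hQ.lintegral_edist_sq_le.trans_eq ?_
  simp

lemma W2_sum_lintegral_smul_dirac_sq_le [Fintype ι] (μ : Measure E) {φ : ι → E → ℝ≥0} (x : ι → E)
    (hφ : ∀ i, Continuous (φ i)) (hsum : ∀ z, ∑ i, φ i z = 1) :
    W2 μ (∑ i, (∫⁻ z, φ i z ∂μ) • Measure.dirac (x i)) ^ 2 ≤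
      ∫⁻ z, (∑ i, φ i z * nndist z (x i) ^ 2 : ℝ≥0) ∂μ := by
  have hm : ∀ i, Measurable fun z => (φ i z : ℝ≥0∞) := fun i => by fun_prop
  have hc : IsCoupling
      (∑ i, (μ.withDensity fun z => φ i z).map fun z => (z, x i)) μ
      (∑ i, (∫⁻ z, φ i z ∂μ) • Measure.dirac (x i)) := by
    constructor
    · rw [Measure.map_finset_sum (by fun_prop)]
      calc _ = ∑ i, μ.withDensity fun z => (φ i z : ℝ≥0∞) := by
            refine Finset.sum_congr rfl fun i _ => ?_
            rw [Measure.map_map measurable_fst (by fun_prop)]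
            exact Measure.map_id
        _ = μ := by
            ext s hs
            simp only [Measure.coe_finsetSum, Finset.sum_apply, withDensity_apply _ hs]
            rw [← lintegral_finsetSum _ fun i _ => hm i]
            simp [← ENNReal.ofNNReal_finsetSum, hsum]
    · rw [Measure.map_finset_sum (by fun_prop)]
      refine Finset.sum_congr rfl fun i _ => ?_
      rw [Measure.map_map measurable_snd (by fun_prop)]
      calc _ = (μ.withDensity fun z => (φ i z : ℝ≥0∞)).map fun _ => x i := rfl
        _ = _ := by
          rw [Measure.map_const, withDensity_apply _ MeasurableSet.univ, setLIntegral_univ]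
  refine hc.W2_sq_le.trans_eq ?_
  rw [lintegral_finsetSum_measure]
  push_cast
  rw [lintegral_finsetSum _ fun i _ => by fun_prop]
  refine Finset.sum_congr rfl fun i _ => ?_
  rw [lintegral_map (by fun_prop) (by fun_prop),
    lintegral_withDensity_eq_lintegral_mul _ (hm i) (by fun_prop)]
  refine lintegral_congr fun z => ?_
  simp only [Pi.mul_apply, edist_nndist]

/-- A finite continuous partition of unity whose associated quantization error is small. -/
lemma exists_partition_lintegral_le [CompleteSpace E] (μ : Measure E) [IsProbabilityMeasure μ]
    (hμ : ∫⁻ z, ‖z‖ₑ ^ 2 ∂μ ≠ ⊤) {η : ℝ≥0} (hη : 0 < η) :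
    ∃ (t : Finset E) (φ : Option t → E → ℝ≥0) (x : Option t → E),
      (∀ i, Continuous (φ i)) ∧ (∀ z, ∑ i, φ i z = 1) ∧
      ∫⁻ z, (∑ i, φ i z * nndist z (x i) ^ 2 : ℝ≥0) ∂μ ≤ 2 * η ^ 2 := by
  have : IsFiniteMeasure (μ.withDensity fun z => ‖z‖ₑ ^ 2) := isFiniteMeasure_withDensity hμ
  obtain ⟨K, hK, hKle⟩ := isTightMeasureSet_iff_exists_isCompact_measure_compl_le.1
    (isTightMeasureSet_singleton (μ := μ.withDensity fun z => ‖z‖ₑ ^ 2)) (η ^ 2 : ℝ≥0∞)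
    (by positivity)
  replace hKle := hKle _ rfl
  rw [withDensity_apply _ hK.measurableSet.compl] at hKle
  obtain ⟨t', -, ht', hcov⟩ := hK.finite_cover_balls (e := (η / 2 : ℝ≥0)) (by positivity)
  lift t' to Finset E using ht'
  set S : E → ℝ≥0 := fun z => ∑ y : t', (η - nndist z y) with hS
  have hScont : Continuous S := by fun_prop
  set D : E → ℝ≥0 := fun z => max (η / 2) (S z) with hD
  have hDpos : ∀ z, D z ≠ 0 := fun z => (lt_max_of_lt_left (by positivity)).ne'
  have hDcont : Continuous D := by fun_prop
  set φ : Option t' → E → ℝ≥0 := fun i z =>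
    i.elim (η / 2 - S z) (fun y => η - nndist z y) / D z with hφ
  have hφsum : ∀ z, ∑ i, φ i z = 1 := by
    intro z
    simp only [hφ, Fintype.sum_option, Option.elim, ← Finset.sum_div]
    rw [div_eq_one_iff_eq (hDpos z)]
    exact tsub_add_eq_max
  refine ⟨t', φ, fun i => i.elim 0 (fun y => y), ?_, hφsum, ?_⟩
  · rintro (_ | y)
    · exact Continuous.div (by simp only [Option.elim]; fun_prop) hDcont hDpos
    · exact Continuous.div (by simp only [Option.elim]; fun_prop) hDcont hDpos
  have hnone : ∀ z ∈ K, φ none z = 0 := by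
    intro z hz
    obtain ⟨y, hy, hzy⟩ := mem_iUnion₂.1 (hcov hz)
    have hzy' : nndist z y ≤ η / 2 := by
      rw [← NNReal.coe_le_coe]; exact (Metric.mem_ball.1 hzy).le
    have h1 : η / 2 ≤ η - nndist z y := by
      refine le_tsub_of_add_le_left ?_
      calc nndist z y + η / 2 ≤ η / 2 + η / 2 := by gcongr
        _ = η := add_halves η
    have h2 : η / 2 ≤ S z := h1.trans
      (Finset.single_le_sum (f := fun y : t' => η - nndist z y) (fun _ _ => zero_le)
        (Finset.mem_univ (⟨y, hy⟩ : t')))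
    simp [hφ, tsub_eq_zero_of_le h2]
  have hpt : ∀ z, ((∑ i, φ i z * nndist z (i.elim 0 (fun y => (y : E))) ^ 2 : ℝ≥0) : ℝ≥0∞) ≤
      Kᶜ.indicator (fun z => ‖z‖ₑ ^ 2) z + η ^ 2 := by
    intro z
    rw [Fintype.sum_option, ENNReal.coe_add]
    have hone : ∀ i, φ i z ≤ 1 := fun i => by
      rw [← hφsum z]
      exact Finset.single_le_sum (f := fun i => φ i z) (fun _ _ => zero_le) (Finset.mem_univ i)
    refine add_le_add ?_ ?_
    · by_cases hz : z ∈ K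
      · simp [hnone z hz]
      · rw [indicator_of_mem hz]
        have := mul_le_of_le_one_left (zero_le (a := ‖z‖₊ ^ 2)) (hone none)
        simpa [enorm_eq_nnnorm] using ENNReal.coe_le_coe.2 this
    · rw [← ENNReal.coe_pow, ENNReal.coe_le_coe]
      calc ∑ y : t', φ (some y) z * nndist z y ^ 2 ≤ ∑ y : t', φ (some y) z * η ^ 2 := by
            refine Finset.sum_le_sum fun y _ => ?_
            rcases le_total (nndist z y) η with h | h
            · gcongr
            · simp [hφ, tsub_eq_zero_of_le h]
        _ = (∑ y : t', φ (some y) z) * η ^ 2 := by rw [Finset.sum_mul]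
        _ ≤ 1 * η ^ 2 := by
            gcongr
            rw [← hφsum z, Fintype.sum_option]
            exact le_add_self
        _ = η ^ 2 := one_mul _
  calc _ ≤ ∫⁻ z, Kᶜ.indicator (fun z => ‖z‖ₑ ^ 2) z + η ^ 2 ∂μ := lintegral_mono hpt
    _ = ∫⁻ z in Kᶜ, ‖z‖ₑ ^ 2 ∂μ + η ^ 2 := by
        rw [lintegral_add_right _ measurable_const, lintegral_indicator hK.measurableSet.compl]
        simp
    _ ≤ 2 * η ^ 2 := by rw [two_mul]; gcongr

/-- Weak convergence together with convergence of second moments implies convergence in `W2`. -/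
lemma tendsto_W2_of_tendsto [CompleteSpace E] {F : Filter ι} {Ps : ι → ProbabilityMeasure E}
    {P : ProbabilityMeasure E} (hP : Tendsto Ps F (𝓝 P))
    (hfin : ∫⁻ z, ‖z‖ₑ ^ 2 ∂(P : Measure E) ≠ ⊤)
    (hlim : Tendsto (fun i => ∫⁻ z, ‖z‖ₑ ^ 2 ∂(Ps i : Measure E)) F
      (𝓝 (∫⁻ z, ‖z‖ₑ ^ 2 ∂(P : Measure E)))) :
    Tendsto (fun i => W2 (Ps i : Measure E) (P : Measure E)) F (𝓝 0) := by
  rw [ENNReal.tendsto_nhds_zero]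
  intro ε hε
  obtain ⟨e, he, heε⟩ := ENNReal.lt_iff_exists_nnreal_btwn.1 hε
  rw [ENNReal.coe_pos] at he
  set η : ℝ≥0 := e / 5 with hηdef
  have hη : 0 < η := by positivity
  obtain ⟨t, φ, x, hφ, hsum, hcost⟩ := exists_partition_lintegral_le (P : Measure E) hfin hη
  set f : E → ℝ≥0 := fun z => ∑ i, φ i z * nndist z (x i) ^ 2 with hf
  set M : ℝ≥0 := ∑ i, ‖x i‖₊ ^ 2 with hM
  set h : E → ℝ≥0 := fun z => 2 * (‖z‖₊ ^ 2 + M) with hh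
  have hfh : ∀ z, f z ≤ h z := by
    intro z
    calc f z ≤ ∑ i, φ i z * (2 * (‖z‖₊ ^ 2 + M)) := by
          refine Finset.sum_le_sum fun i _ => ?_
          gcongr
          have h1 : nndist z (x i) ^ 2 ≤ 2 * (‖z‖₊ ^ 2 + ‖x i‖₊ ^ 2) := by
            have := edist_sq_le z (x i)
            simp only [edist_nndist, enorm_eq_nnnorm] at this
            exact_mod_cast this
          refine h1.trans ?_
          gcongr
          exact Finset.single_le_sum (f := fun i => ‖x i‖₊ ^ 2) (fun _ _ => zero_le)
            (Finset.mem_univ i)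
      _ = h z := by rw [← Finset.sum_mul, hsum, one_mul]
  have hint : ∀ Q : ProbabilityMeasure E, ∫⁻ z, h z ∂(Q : Measure E) =
      2 * (∫⁻ z, ‖z‖ₑ ^ 2 ∂(Q : Measure E) + M) := by
    intro Q
    simp only [hh, ENNReal.coe_mul, ENNReal.coe_add, ENNReal.coe_pow, ← enorm_eq_nnnorm]
    rw [lintegral_const_mul _ (by fun_prop), lintegral_add_right _ measurable_const]
    simp
  have hflim := tendsto_lintegral_of_le hP (f := f) (h := h) (by fun_prop) (by fun_prop) hfh
    (by rw [hint]; exact ENNReal.mul_ne_top (by simp) (by simp [hfin]))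
    (by simp only [hint]
        exact ENNReal.Tendsto.const_mul (hlim.add tendsto_const_nhds) (.inr (by simp)))
  have hφ1 : ∀ i z, φ i z ≤ 1 := fun i z => by
    rw [← hsum z]
    exact Finset.single_le_sum (f := fun i => φ i z) (fun _ _ => zero_le) (Finset.mem_univ i)
  have hplim : ∀ i, Tendsto (fun k => ∫⁻ z, φ i z ∂(Ps k : Measure E)) F
      (𝓝 (∫⁻ z, φ i z ∂(P : Measure E))) := fun i =>
    tendsto_lintegral_of_le hP (h := fun _ => 1) (hφ i) continuous_const (hφ1 i) (by simp)
      (by simpa using tendsto_const_nhds)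
  have htot : ∀ Q : ProbabilityMeasure E, ∑ i, ∫⁻ z, φ i z ∂(Q : Measure E) = 1 := by
    intro Q
    rw [← lintegral_finsetSum _ fun i _ => by fun_prop]
    simp [← ENNReal.ofNNReal_finsetSum, hsum]
  have hpfin : ∀ i, ∫⁻ z, φ i z ∂(P : Measure E) ≠ ⊤ := fun i =>
    ne_top_of_le_ne_top (b := 1) (by simp)
      ((Finset.single_le_sum (f := fun i => ∫⁻ z, φ i z ∂(P : Measure E)) (fun _ _ => zero_le)
        (Finset.mem_univ i)).trans_eq (htot P))
  have hdisc : Tendsto (fun k => 2 * (∑ i, (∫⁻ z, φ i z ∂(Ps k : Measure E) -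
        ∫⁻ z, φ i z ∂(P : Measure E)) * ‖x i‖ₑ ^ 2 + ∑ i, (∫⁻ z, φ i z ∂(P : Measure E) -
        ∫⁻ z, φ i z ∂(Ps k : Measure E)) * ‖x i‖ₑ ^ 2)) F (𝓝 0) := by
    have h1 : ∀ i, Tendsto (fun k => (∫⁻ z, φ i z ∂(Ps k : Measure E) -
        ∫⁻ z, φ i z ∂(P : Measure E)) * ‖x i‖ₑ ^ 2) F (𝓝 0) := fun i => by
      simpa using ENNReal.Tendsto.mul_const
        (ENNReal.Tendsto.sub (hplim i)
          (tendsto_const_nhds (x := ∫⁻ z, φ i z ∂(P : Measure E))) (.inl (hpfin i)))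
        (b := ‖x i‖ₑ ^ 2) (.inr (by simp))
    have h2 : ∀ i, Tendsto (fun k => (∫⁻ z, φ i z ∂(P : Measure E) -
        ∫⁻ z, φ i z ∂(Ps k : Measure E)) * ‖x i‖ₑ ^ 2) F (𝓝 0) := fun i => by
      simpa using ENNReal.Tendsto.mul_const
        (ENNReal.Tendsto.sub tendsto_const_nhds (hplim i) (.inl (hpfin i)))
        (b := ‖x i‖ₑ ^ 2) (.inr (by simp))
    simpa using ENNReal.Tendsto.const_mul (a := 2)
      ((tendsto_finsetSum Finset.univ fun i _ => h1 i).add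
        (tendsto_finsetSum Finset.univ fun i _ => h2 i)) (.inr (by simp))
  have hη2 : (2 * η ^ 2 : ℝ≥0∞) < (2 * η : ℝ≥0∞) ^ 2 := by
    have : 2 * η ^ 2 < (2 * η) ^ 2 := by
      rw [mul_pow]; gcongr; norm_num
    exact_mod_cast this
  filter_upwards [hflim.eventually_lt_const (hcost.trans_lt hη2),
    hdisc.eventually_lt_const (u := (η : ℝ≥0∞) ^ 2) (by positivity)] with k hk1 hk2
  set σ : ProbabilityMeasure E → Measure E :=
    fun Q => ∑ i, (∫⁻ z, φ i z ∂(Q : Measure E)) • Measure.dirac (x i)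
  have hσ : ∀ Q, IsProbabilityMeasure (σ Q) := fun Q => ⟨by simpa [σ] using htot Q⟩
  have b1 : W2 (Ps k : Measure E) (σ (Ps k)) ≤ 2 * η :=
    W2_le_of_sq_le ((W2_sum_lintegral_smul_dirac_sq_le _ x hφ hsum).trans hk1.le)
  have b2 : W2 (σ (Ps k)) (σ P) ≤ η :=
    W2_le_of_sq_le ((W2_sum_smul_dirac_sq_le x _ _ ((htot _).trans (htot _).symm)
      (by rw [htot]; simp)).trans hk2.le)
  have b3 : W2 (σ P) (P : Measure E) ≤ 2 * η := by
    rw [W2_comm]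
    exact W2_le_of_sq_le
      ((W2_sum_lintegral_smul_dirac_sq_le _ x hφ hsum).trans (hcost.trans hη2.le))
  calc W2 (Ps k : Measure E) P ≤ W2 (Ps k : Measure E) (σ (Ps k)) + W2 (σ (Ps k)) P :=
        W2_triangle _ _ _
    _ ≤ W2 (Ps k : Measure E) (σ (Ps k)) + (W2 (σ (Ps k)) (σ P) + W2 (σ P) P) := by
        gcongr
        exact W2_triangle _ _ _
    _ ≤ 2 * η + (η + 2 * η) := by gcongr
    _ = ((5 * η : ℝ≥0) : ℝ≥0∞) := by push_cast; ring
    _ = e := by rw [hηdef, mul_div_cancel₀ _ (by norm_num)]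
    _ ≤ ε := heε.le

end Discretization

section Limits

variable {E : Type*} [NormedAddCommGroup E] [MeasurableSpace E] [BorelSpace E]
  {ι : Type*}

/-- Couplings with a fixed second marginal and convergent costs converge along an ultrafilter, and
the cost is lower semicontinuous in the limit. -/
lemma exists_tendsto_coupling [ProperSpace E] {F : Ultrafilter ι} {μ : Measure E} (hμ : MemP2 μ)
    {ρs : ι → Measure E} {Ps : ι → ProbabilityMeasure (E × E)}
    (hPs : ∀ i, IsCoupling (Ps i : Measure (E × E)) (ρs i) μ)
    {a : ι → ℝ≥0∞} {t : ℝ≥0∞} (ht : t ≠ ⊤) (ha : Tendsto a F (𝓝 t))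
    (hle : ∀ i, ∫⁻ q, edist q.1 q.2 ^ 2 ∂(Ps i : Measure (E × E)) ≤ a i) :
    ∃ P : ProbabilityMeasure (E × E), Tendsto Ps F (𝓝 P) ∧
      (P : Measure (E × E)).map Prod.snd = μ ∧
      ∫⁻ q, edist q.1 q.2 ^ 2 ∂(P : Measure (E × E)) ≤ t := by
  have hC : 2 * (t + 1) + 3 * ∫⁻ x, ‖x‖ₑ ^ 2 ∂μ ≠ ⊤ :=
    ENNReal.add_ne_top.2 ⟨ENNReal.mul_ne_top (by simp) (by simp [ht]),
      ENNReal.mul_ne_top (by simp) hμ.2.ne⟩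
  have hbound : ∀ᶠ i in F, Ps i ∈ closure {P : ProbabilityMeasure (E × E) |
      ∫⁻ q, ‖q‖ₑ ^ 2 ∂(P : Measure (E × E)) ≤ 2 * (t + 1) + 3 * ∫⁻ x, ‖x‖ₑ ^ 2 ∂μ} := by
    filter_upwards [ha.eventually_lt_const (ENNReal.lt_add_right ht one_ne_zero)] with i hi
    refine subset_closure ?_
    calc ∫⁻ q, ‖q‖ₑ ^ 2 ∂(Ps i : Measure (E × E))
        ≤ ∫⁻ q, 2 * edist q.1 q.2 ^ 2 + 3 * ‖q.2‖ₑ ^ 2 ∂(Ps i : Measure (E × E)) :=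
          lintegral_mono enorm_prod_sq_le
      _ = 2 * ∫⁻ q, edist q.1 q.2 ^ 2 ∂(Ps i : Measure (E × E)) +
            3 * ∫⁻ x, ‖x‖ₑ ^ 2 ∂μ := by
          rw [lintegral_add_right _ (by fun_prop), lintegral_const_mul _ (by fun_prop),
            lintegral_const_mul _ (by fun_prop),
            (hPs i).lintegral_snd (f := fun x => ‖x‖ₑ ^ 2) (by fun_prop)]
      _ ≤ 2 * (t + 1) + 3 * ∫⁻ x, ‖x‖ₑ ^ 2 ∂μ := by
          gcongr
          exact (hle i).trans hi.le
  obtain ⟨P, -, hP⟩ := (isCompact_closure_setOf_lintegral_enorm_sq_le hC).ultrafilter_le_nhds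
    (F.map Ps) (le_principal_iff.2 hbound)
  replace hP : Tendsto Ps F (𝓝 P) := hP
  refine ⟨P, hP, ?_, ?_⟩
  · have h1 := ProbabilityMeasure.tendsto_map_of_tendsto_of_continuous Ps P hP continuous_snd
    have h2 : (fun i => (Ps i).map (f := Prod.snd) continuous_snd.measurable.aemeasurable) =
        fun _ => (⟨μ, hμ.1⟩ : ProbabilityMeasure E) :=
      funext fun i => Subtype.ext (hPs i).2
    rw [h2] at h1
    exact congrArg (fun Q : ProbabilityMeasure E => (Q : Measure E))
      (tendsto_nhds_unique h1 tendsto_const_nhds)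
  · have := lintegral_le_of_tendsto_of_eventually_le hP
      (f := fun q => nndist q.1 q.2 ^ 2) (by fun_prop) ha
      (.of_forall fun i => by simpa only [ENNReal.coe_pow, ← edist_nndist] using hle i)
    simpa only [ENNReal.coe_pow, ← edist_nndist] using this

/-- If couplings with a fixed second marginal converge weakly and their costs converge, then the
first marginals converge in `W2`. -/
lemma tendsto_W2_fst_of_tendsto_coupling [SecondCountableTopology E] [CompleteSpace E]
    {F : Filter ι} {μ : Measure E} (hμ : MemP2 μ) {ρs : ι → Measure E} {ρ : Measure E}
    {Ps : ι → ProbabilityMeasure (E × E)} {P : ProbabilityMeasure (E × E)}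
    (hPs : ∀ i, IsCoupling (Ps i : Measure (E × E)) (ρs i) μ)
    (hPμ : IsCoupling (P : Measure (E × E)) ρ μ)
    (hP : Tendsto Ps F (𝓝 P))
    (hfin : ∫⁻ q, edist q.1 q.2 ^ 2 ∂(P : Measure (E × E)) ≠ ⊤)
    (hcost : Tendsto (fun i => ∫⁻ q, edist q.1 q.2 ^ 2 ∂(Ps i : Measure (E × E))) F
      (𝓝 (∫⁻ q, edist q.1 q.2 ^ 2 ∂(P : Measure (E × E))))) :
    Tendsto (fun i => W2 (ρs i) ρ) F (𝓝 0) := by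
  set h : E × E → ℝ≥0 := fun q => 2 * (nndist q.1 q.2 ^ 2 + ‖q.2‖₊ ^ 2) with hh
  have hint : ∀ (ν : Measure E) (Q : Measure (E × E)), IsCoupling Q ν μ → ∫⁻ q, h q ∂Q =
      2 * (∫⁻ q, edist q.1 q.2 ^ 2 ∂Q + ∫⁻ x, ‖x‖ₑ ^ 2 ∂μ) := by
    intro ν Q hQ
    simp only [hh, ENNReal.coe_mul, ENNReal.coe_add, ENNReal.coe_pow, ← enorm_eq_nnnorm,
      ← edist_nndist]
    rw [ENNReal.coe_ofNat, lintegral_const_mul _ (by fun_prop), lintegral_add_right _ (by fun_prop),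
      hQ.lintegral_snd (f := fun x => ‖x‖ₑ ^ 2) (by fun_prop)]
  have hfh : ∀ q : E × E, ‖q.1‖₊ ^ 2 ≤ h q := fun q => by
    have := enorm_sq_le q.1 q.2
    simp only [edist_nndist, enorm_eq_nnnorm] at this
    exact_mod_cast this
  have hhfin : ∫⁻ q, h q ∂(P : Measure (E × E)) ≠ ⊤ := by
    rw [hint _ _ hPμ]
    exact ENNReal.mul_ne_top (by simp) (ENNReal.add_ne_top.2 ⟨hfin, hμ.2.ne⟩)
  have hlim := tendsto_lintegral_of_le hP (f := fun q => ‖q.1‖₊ ^ 2) (h := h)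
    (by fun_prop) (by fun_prop) hfh hhfin (by
      rw [hint _ _ hPμ]
      simp only [fun i => hint _ _ (hPs i)]
      exact ENNReal.Tendsto.const_mul (hcost.add tendsto_const_nhds) (.inr (by simp)))
  have hmom : ∀ (ν : Measure E) (Q : Measure (E × E)), IsCoupling Q ν μ →
      ∫⁻ q, ((‖q.1‖₊ ^ 2 : ℝ≥0) : ℝ≥0∞) ∂Q = ∫⁻ x, ‖x‖ₑ ^ 2 ∂ν := by
    intro ν Q hQ
    simp only [ENNReal.coe_pow, ← enorm_eq_nnnorm]
    exact hQ.lintegral_fst (f := fun x => ‖x‖ₑ ^ 2) (by fun_prop)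
  have hmap := ProbabilityMeasure.tendsto_map_of_tendsto_of_continuous Ps P hP continuous_fst
  have hfst : ∀ (ν : Measure E) (Q : ProbabilityMeasure (E × E)), IsCoupling (Q : Measure _) ν μ →
      ((Q.map (f := Prod.fst) continuous_fst.measurable.aemeasurable : ProbabilityMeasure E) :
        Measure E) = ν := fun ν Q hQ => hQ.1
  have := tendsto_W2_of_tendsto hmap (by
      rw [hfst _ _ hPμ, ← hmom _ _ hPμ]
      exact ne_top_of_le_ne_top hhfin (lintegral_mono fun q => ENNReal.coe_le_coe.2 (hfh q))) (by
      simp only [fun i => hfst _ _ (hPs i), hfst _ _ hPμ]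
      rw [← hmom _ _ hPμ]
      simpa only [fun i => hmom _ _ (hPs i)] using hlim)
  simpa only [fun i => hfst _ _ (hPs i), hfst _ _ hPμ] using this

end Limits

section Barycenter

variable {E : Type*} [NormedAddCommGroup E] [MeasurableSpace E] [BorelSpace E]
  {ι : Type*} [Fintype ι]

/-- Stability of Wasserstein barycenters under perturbation of the weights. -/
lemma tendsto_W2_barycenter [ProperSpace E] [Nonempty ι] {F : Ultrafilter ℕ}
    (hF : (F : Filter ℕ) ≤ atTop)
    {μ : ι → Measure E} (hμ : ∀ n, MemP2 (μ n)) {w : ι → ℝ≥0∞} (hw0 : ∀ n, w n ≠ 0)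
    (hwtop : ∀ n, w n ≠ ⊤) {ws : ℕ → ι → ℝ≥0∞} (hws : ∀ n, Tendsto (fun k => ws k n) F (𝓝 (w n)))
    {β : Measure E} (hβ : MemP2 β)
    (hmin : ∀ ρ, MemP2 ρ → ∑ n, w n * W2 β (μ n) ^ 2 ≤ ∑ n, w n * W2 ρ (μ n) ^ 2)
    (huniq : ∀ ρ, MemP2 ρ →
      ∑ n, w n * W2 ρ (μ n) ^ 2 = ∑ n, w n * W2 β (μ n) ^ 2 → ρ = β)
    {ρs : ℕ → Measure E} (hρs : ∀ k, MemP2 (ρs k))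
    (hmins : ∀ k, ∑ n, ws k n * W2 (ρs k) (μ n) ^ 2 ≤ ∑ n, ws k n * W2 β (μ n) ^ 2) :
    Tendsto (fun k => W2 (ρs k) β) F (𝓝 0) := by
  have hβfin : ∀ n, W2 β (μ n) ^ 2 ≠ ⊤ := fun n => ENNReal.pow_ne_top (hβ.W2_ne_top (hμ n))
  have hGfin : ∑ n, w n * W2 β (μ n) ^ 2 ≠ ⊤ :=
    ENNReal.sum_ne_top.2 fun n _ => ENNReal.mul_ne_top (hwtop n) (hβfin n)
  have hconv : ∀ n, ∃ t, Tendsto (fun k => W2 (ρs k) (μ n) ^ 2) F (𝓝 t) := fun n =>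
    ⟨_, (F.map fun k => W2 (ρs k) (μ n) ^ 2).le_nhds_lim⟩
  choose t ht using hconv
  have hle : ∑ n, w n * t n ≤ ∑ n, w n * W2 β (μ n) ^ 2 := by
    refine le_of_tendsto_of_tendsto' (b := (F : Filter ℕ)) (tendsto_finsetSum _ fun n _ => ?_)
      (tendsto_finsetSum _ fun n _ => ?_) hmins
    · exact ENNReal.Tendsto.mul (hws n) (.inl (hw0 n)) (ht n) (.inr (hwtop n))
    · exact ENNReal.Tendsto.mul_const (hws n) (.inr (hβfin n))
  have htfin : ∀ n, t n ≠ ⊤ := by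
    intro n hn
    refine ENNReal.sum_ne_top.1 (ne_top_of_le_ne_top hGfin hle) n (Finset.mem_univ n) ?_
    rw [hn, ENNReal.mul_top (hw0 n)]
  have hcoup : ∀ k n, ∃ P : ProbabilityMeasure (E × E),
      IsCoupling (P : Measure (E × E)) (ρs k) (μ n) ∧
      ∫⁻ q, edist q.1 q.2 ^ 2 ∂(P : Measure (E × E)) ≤
        W2 (ρs k) (μ n) ^ 2 + (k : ℝ≥0∞)⁻¹ := by
    intro k n
    have := (hρs k).1
    obtain ⟨P, hP, hlt⟩ := exists_isCoupling_lt (ENNReal.lt_add_right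
      (ENNReal.pow_ne_top (n := 2) ((hρs k).W2_ne_top (hμ n)))
      (ENNReal.inv_ne_zero.2 (ENNReal.natCast_ne_top k)))
    exact ⟨⟨P, hP.isProbabilityMeasure_s4⟩, hP, hlt.le⟩
  choose Ps hPs hPsle using hcoup
  have hadd : ∀ n, Tendsto (fun k => W2 (ρs k) (μ n) ^ 2 + (k : ℝ≥0∞)⁻¹) F (𝓝 (t n)) := by
    intro n
    simpa using (ht n).add (ENNReal.tendsto_inv_nat_nhds_zero.mono_left hF)
  choose P hP hPsnd hPle using fun n =>
    exists_tendsto_coupling (hμ n) (fun k => hPs k n) (htfin n) (hadd n) fun k => hPsle k n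
  obtain ⟨m⟩ := ‹Nonempty ι›
  set ρ : ProbabilityMeasure E :=
    (P m).map (f := Prod.fst) continuous_fst.measurable.aemeasurable with hρ
  have hPρ : ∀ n, IsCoupling (P n : Measure (E × E)) ρ (μ n) := by
    intro n
    refine ⟨?_, hPsnd n⟩
    have h1 := fun n =>
      ProbabilityMeasure.tendsto_map_of_tendsto_of_continuous _ _ (hP n) continuous_fst
    have h2 : (fun k => (Ps k n).map (f := Prod.fst) continuous_fst.measurable.aemeasurable) =
        fun k => (Ps k m).map (f := Prod.fst) continuous_fst.measurable.aemeasurable :=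
      funext fun k => Subtype.ext ((hPs k n).1.trans (hPs k m).1.symm)
    have h3 := h1 n
    rw [h2] at h3
    exact congrArg (fun Q : ProbabilityMeasure E => (Q : Measure E))
      (tendsto_nhds_unique h3 (h1 m))
  have hρt : ∀ n, W2 (ρ : Measure E) (μ n) ^ 2 ≤ t n := fun n =>
    (hPρ n).W2_sq_le.trans (hPle n)
  have hρ2 : MemP2 (ρ : Measure E) := by
    refine ⟨inferInstance, ?_⟩
    calc ∫⁻ x, (‖x‖₊ : ℝ≥0∞) ^ 2 ∂(ρ : Measure E)
        = ∫⁻ q, ‖q.1‖ₑ ^ 2 ∂(P m : Measure (E × E)) :=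
          ((hPρ m).lintegral_fst (f := fun x => ‖x‖ₑ ^ 2) (by fun_prop)).symm
      _ ≤ ∫⁻ q, 2 * (edist q.1 q.2 ^ 2 + ‖q.2‖ₑ ^ 2) ∂(P m : Measure (E × E)) :=
          lintegral_mono fun q => enorm_sq_le _ _
      _ = 2 * (∫⁻ q, edist q.1 q.2 ^ 2 ∂(P m : Measure (E × E)) + ∫⁻ x, ‖x‖ₑ ^ 2 ∂(μ m)) := by
          rw [lintegral_const_mul _ (by fun_prop), lintegral_add_right _ (by fun_prop),
            (hPρ m).lintegral_snd (f := fun x => ‖x‖ₑ ^ 2) (by fun_prop)]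
      _ < ⊤ := ENNReal.mul_lt_top (by simp)
          (ENNReal.add_lt_top.2 ⟨(hPle m).trans_lt (htfin m).lt_top, (hμ m).2⟩)
  have hρle : ∑ n, w n * W2 (ρ : Measure E) (μ n) ^ 2 ≤ ∑ n, w n * t n :=
    Finset.sum_le_sum fun n _ => by gcongr; exact hρt n
  have hρβ : (ρ : Measure E) = β := huniq _ hρ2 (le_antisymm (hρle.trans hle) (hmin _ hρ2))
  rw [hρβ] at hPρ hρt
  have htm : t m ≤ W2 β (μ m) ^ 2 := by
    classical
    rw [← Finset.add_sum_erase _ _ (Finset.mem_univ m),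
      ← Finset.add_sum_erase _ (fun n => w n * W2 β (μ n) ^ 2) (Finset.mem_univ m)] at hle
    have hsub : ∑ n ∈ Finset.univ.erase m, w n * W2 β (μ n) ^ 2 ≤
        ∑ n ∈ Finset.univ.erase m, w n * t n :=
      Finset.sum_le_sum fun n _ => by gcongr; exact hρt n
    have hfin : ∑ n ∈ Finset.univ.erase m, w n * t n ≠ ⊤ :=
      ENNReal.sum_ne_top.2 fun n _ => ENNReal.mul_ne_top (hwtop n) (htfin n)
    have := (ENNReal.add_le_add_iff_right hfin).1 (hle.trans (add_le_add_right hsub _))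
    exact (ENNReal.mul_le_mul_iff_right (hw0 m) (hwtop m)).1 this
  have hcost : ∫⁻ q, edist q.1 q.2 ^ 2 ∂(P m : Measure (E × E)) = t m :=
    le_antisymm (hPle m) (htm.trans (hPρ m).W2_sq_le)
  refine tendsto_W2_fst_of_tendsto_coupling (hμ m) (fun k => hPs k m) (hPρ m) (hP m)
    (by rw [hcost]; exact htfin m) ?_
  rw [hcost]
  exact tendsto_of_tendsto_of_tendsto_of_le_of_le (ht m) (hadd m)
    (fun k => (hPs k m).W2_sq_le) fun k => hPsle k m

lemma tendsto_W2_left [SecondCountableTopology E] [CompleteSpace E] {F : Filter ℕ} {ν μ : Measure E}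
    (hν : MemP2 ν) (hμ : MemP2 μ) {νs : ℕ → Measure E} (hνs : ∀ k, MemP2 (νs k))
    (h : Tendsto (fun k => W2 ν (νs k)) F (𝓝 0)) :
    Tendsto (fun k => W2 (νs k) μ) F (𝓝 (W2 ν μ)) := by
  have := hν.1
  have := fun k => (hνs k).1
  have hlow : Tendsto (fun k => W2 ν μ - W2 ν (νs k)) F (𝓝 (W2 ν μ)) := by
    simpa using ENNReal.Tendsto.sub (tendsto_const_nhds (x := W2 ν μ)) h
      (.inl (hν.W2_ne_top hμ))
  have hup : Tendsto (fun k => W2 ν (νs k) + W2 ν μ) F (𝓝 (W2 ν μ)) := by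
    simpa using h.add (tendsto_const_nhds (x := W2 ν μ))
  refine tendsto_of_tendsto_of_tendsto_of_le_of_le hlow hup (fun k => ?_) fun k => ?_
  · exact tsub_le_iff_left.2 (W2_triangle _ _ _)
  · dsimp only
    rw [W2_comm ν (νs k)]
    exact W2_triangle _ _ _

end Barycenter

/-- Continuity of the IRLS updating map.
The map `U : ν ↦ argmin_ρ Σₙ (πₙ / W₂(ν, μₙ)) W₂²(ρ, μₙ)` is continuous w.r.t. `W₂` on
the set of `ν ∈ P₂(ℝᵈ)` with `W₂(ν, μₙ) > 0` for all `n`. -/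
theorem irls_update_continuous {d N : ℕ}
    (μ : Fin N → Measure (Rd d)) (π : Fin N → ℝ)
    (hμ : ∀ n, MemP2 (μ n)) (hac : ∀ n, μ n ≪ (volume : Measure (Rd d)))
    (hπ : ∀ n, 0 < π n) (hπsum : ∑ n, π n = 1)
    (U : Measure (Rd d) → Measure (Rd d))
    -- `U ν` is the unique minimizer of the reweighted barycenter functional `G_ν`:
    (hU : ∀ ν : Measure (Rd d), MemP2 ν → (∀ n, W2 ν (μ n) ≠ 0) →
      MemP2 (U ν) ∧
      (∀ ρ : Measure (Rd d), MemP2 ρ →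
        (∑ n, ENNReal.ofReal (π n) / W2 ν (μ n) * W2 (U ν) (μ n) ^ 2) ≤
          ∑ n, ENNReal.ofReal (π n) / W2 ν (μ n) * W2 ρ (μ n) ^ 2) ∧
      (∀ ρ : Measure (Rd d), MemP2 ρ →
        (∑ n, ENNReal.ofReal (π n) / W2 ν (μ n) * W2 ρ (μ n) ^ 2) =
          (∑ n, ENNReal.ofReal (π n) / W2 ν (μ n) * W2 (U ν) (μ n) ^ 2) → ρ = U ν)) :
    ∀ ν : Measure (Rd d), MemP2 ν → (∀ n, W2 ν (μ n) ≠ 0) →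
      ∀ ε : ℝ≥0∞, 0 < ε → ∃ δ : ℝ≥0∞, 0 < δ ∧
        ∀ ν' : Measure (Rd d), MemP2 ν' → (∀ n, W2 ν' (μ n) ≠ 0) →
          W2 ν ν' < δ → W2 (U ν) (U ν') < ε := by
  intro ν hν hνμ ε hε
  by_contra! hcon
  choose νs hνs hνsμ hclose hfar using fun k : ℕ =>
    hcon (k : ℝ≥0∞)⁻¹ (ENNReal.inv_pos.2 (ENNReal.natCast_ne_top k))
  have hνlim : Tendsto (fun k => W2 ν (νs k)) atTop (𝓝 0) :=
    tendsto_of_tendsto_of_tendsto_of_le_of_le tendsto_const_nhds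
      ENNReal.tendsto_inv_nat_nhds_zero (fun _ => zero_le) fun k => (hclose k).le
  have : Nonempty (Fin N) := by
    by_contra hN
    rw [not_nonempty_iff] at hN
    simp at hπsum
  have hF : ((Ultrafilter.of atTop : Ultrafilter ℕ) : Filter ℕ) ≤ atTop := Ultrafilter.of_le atTop
  obtain ⟨hUν, hmin, huniq⟩ := hU ν hν hνμ
  have hlim := tendsto_W2_barycenter (F := Ultrafilter.of atTop) hF hμ
    (w := fun n => ENNReal.ofReal (π n) / W2 ν (μ n))
    (fun n => ENNReal.div_ne_zero.2
      ⟨(ENNReal.ofReal_pos.2 (hπ n)).ne', hν.W2_ne_top (hμ n)⟩)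
    (fun n => ENNReal.div_ne_top ENNReal.ofReal_ne_top (hνμ n))
    (ws := fun k n => ENNReal.ofReal (π n) / W2 (νs k) (μ n))
    (fun n => ENNReal.Tendsto.const_div
      ((tendsto_W2_left hν (hμ n) hνs hνlim).mono_left hF) (.inr ENNReal.ofReal_ne_top))
    hUν hmin huniq (fun k => (hU _ (hνs k) (hνsμ k)).1)
    fun k => (hU _ (hνs k) (hνsμ k)).2.1 _ hUν
  obtain ⟨k, hk⟩ := (hlim.eventually_lt_const hε).exists
  rw [W2_comm] at hk
  exact (hfar k).not_gt hk
end
end
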